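/- Let p be an odd prime and L a ternary lattice that is stable at p; write L_p = M_p ⊥ U_p with M_p the leading Jordan component. For n∈ℕ let ν_p = ord_p(n). If ord_p(d_L)=0, then α_p(n,L) = 1 + 1/p − 1/p^{(ν_p+2)/2} + ((−p^{−ν_p} n d_L)/p)·1/p^{(ν_p+2)/2} when ν_p is even, and α_p(n,L) = 1 + 1/p − 1/p^{(ν_p+1)/2} − 1/p^{(ν_p+3)/2} when ν_p is odd. If ord_p(d_L)=1, then α_p(n,L) = 1 + (1 − 1/p^{ν_p/2} − 1/p^{(ν_p+2)/2})·((−d_{M_p})/p) when ν_p is even, and α_p(n,L) = 1 + (1 − 1/p^{(ν_p+1)/2} + ((−p^{−(ν_p+1)} n d_L)/p)·1/p^{(ν_p+1)/2})·((−d_{M_p})/p) when ν_p is odd, where (·/p) is the Legendre symbol and d_{M_p} is the discriminant of M_p. -/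

import Mathlib

open scoped BigOperators Classical
open Matrix Filter

noncomputable section

/-! ## Binary quadratic forms, class numbers, and Hurwitz class numbers -/

/-- `(a,b,c)` represents the primitive positive-definite binary quadratic form
`a x² + b x y + c y²` of discriminant `d`. -/
def IsPrimPosDefBQF (d : ℤ) (f : ℤ × ℤ × ℤ) : Prop :=
  f.2.1 ^ 2 - 4 * f.1 * f.2.2 = d ∧ Int.gcd f.1 (Int.gcd f.2.1 f.2.2) = 1 ∧ 0 < f.1

/-- `SL₂(ℤ)`-equivalence of binary quadratic forms. -/
def BQFEquiv (f g : ℤ × ℤ × ℤ) : Prop :=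
  ∃ M : Matrix.SpecialLinearGroup (Fin 2) ℤ,
    g.1 = f.1 * M 0 0 ^ 2 + f.2.1 * M 0 0 * M 1 0 + f.2.2 * M 1 0 ^ 2 ∧
    g.2.1 = 2 * f.1 * M 0 0 * M 0 1 + f.2.1 * (M 0 0 * M 1 1 + M 0 1 * M 1 0) +
        2 * f.2.2 * M 1 0 * M 1 1 ∧
    g.2.2 = f.1 * M 0 1 ^ 2 + f.2.1 * M 0 1 * M 1 1 + f.2.2 * M 1 1 ^ 2

/-- The class number `h(d)`: the number of `SL₂(ℤ)`-classes of primitive positive-definite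
binary quadratic forms of discriminant `d`. -/
def classNum (d : ℤ) : ℕ :=
  Nat.card (Quot fun f g : {f : ℤ × ℤ × ℤ // IsPrimPosDefBQF d f} => BQFEquiv f.1 g.1)

/-- The number of automorphs `w_d`. -/
def wAut (d : ℤ) : ℕ := if d = -3 then 6 else if d = -4 then 4 else 2

def hurwitzNat (N : ℕ) : ℚ :=
  if 0 < N ∧ (N % 4 = 0 ∨ N % 4 = 3) then
    ∑ f ∈ N.divisors.filter fun f => f ^ 2 ∣ N,
      (classNum (-((N / f ^ 2 : ℕ) : ℤ)) : ℚ) / ((wAut (-((N / f ^ 2 : ℕ) : ℤ)) : ℚ) / 2)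
  else 0

/-- Hurwitz class number, with the convention `H(x) = 0` unless `x` is a positive integer
congruent to `0` or `3 (mod 4)`. -/
def hurwitz (x : ℚ) : ℚ := if x.den = 1 ∧ 0 ≤ x.num then hurwitzNat x.num.toNat else 0

/-! ## Kronecker symbol and fundamental discriminants -/

def kron2 (a : ℤ) : ℤ := if a % 2 = 0 then 0 else if a % 8 = 1 ∨ a % 8 = 7 then 1 else -1

/-- The Kronecker symbol `(a / n)` for `n ∈ ℕ`. -/
def kroneckerSym (a : ℤ) (n : ℕ) : ℤ :=
  kron2 a ^ padicValNat 2 n * jacobiSym a (n / 2 ^ padicValNat 2 n)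

/-- Fundamental discriminants. -/
def IsFundamentalDisc (d : ℤ) : Prop :=
  d % 4 = 1 ∧ Squarefree d ∨ d % 4 = 0 ∧ Squarefree (d / 4) ∧ (d / 4 % 4 = 2 ∨ d / 4 % 4 = 3)

/-! ## Ternary quadratic lattices via Gram matrices -/

abbrev TernMat := Matrix (Fin 3) (Fin 3) ℤ

/-- The quadratic form attached to a Gram matrix. -/
def quadVal {R : Type*} [CommRing R] {k : ℕ} (M : Matrix (Fin k) (Fin k) R) (x : Fin k → R) : R :=
  ∑ i, ∑ j, x i * M i j * x j

/-- `A` is the Gram matrix of a positive-definite integral ternary lattice. -/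
def IsLat (A : TernMat) : Prop := A.IsSymm ∧ ∀ x : Fin 3 → ℤ, x ≠ 0 → 0 < quadVal A x

/-- The number of representations of `n` by the lattice with Gram matrix `A`. -/
def rRep (n : ℤ) (A : TernMat) : ℕ := Nat.card {x : Fin 3 → ℤ // quadVal A x = n}

/-- Isometry of ternary lattices via their Gram matrices. -/
def LatIsom (A B : TernMat) : Prop := ∃ U : TernMat, IsUnit U.det ∧ Uᵀ * A * U = B

/-- The number of automorphs `o(L)`. -/
def numAut (A : TernMat) : ℕ := Nat.card {U : TernMat // IsUnit U.det ∧ Uᵀ * A * U = A}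

def padicMat (p : ℕ) [Fact p.Prime] {k : ℕ} (A : Matrix (Fin k) (Fin k) ℤ) :
    Matrix (Fin k) (Fin k) ℤ_[p] := A.map Int.cast

/-- Isometry of `ℤ_p`-lattices given by Gram matrices. -/
def PadicIsomP (p : ℕ) [Fact p.Prime] {k : ℕ} (M N : Matrix (Fin k) (Fin k) ℤ_[p]) : Prop :=
  ∃ U : Matrix (Fin k) (Fin k) ℤ_[p], IsUnit U.det ∧ Uᵀ * M * U = N

/-- `A ⊗ ℤ_p ≅ B ⊗ ℤ_p`. -/
def PadicLatIsom (p : ℕ) (hp : p.Prime) (A B : TernMat) : Prop :=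
  letI : Fact p.Prime := ⟨hp⟩
  PadicIsomP p (padicMat p A) (padicMat p B)

/-- `B` is (the Gram matrix of a lattice) in the genus of `A`. -/
def InGenus (A B : TernMat) : Prop :=
  IsLat B ∧ ∀ (p : ℕ) (hp : p.Prime), PadicLatIsom p hp A B

/-- The mass `w(L)` of the genus of `A`. -/
def massOf (A : TernMat) : ℝ :=
  ∑ᶠ c : Quot fun B C : {B : TernMat // InGenus A B} => LatIsom B.1 C.1,
    ((numAut (Quot.out c).1 : ℝ))⁻¹

/-- The Siegel–Weil average `r(n, gen(L))`. -/
def rGenus (n : ℤ) (A : TernMat) : ℝ :=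
  (massOf A)⁻¹ *
    ∑ᶠ c : Quot fun B C : {B : TernMat // InGenus A B} => LatIsom B.1 C.1,
      (rRep n (Quot.out c).1 : ℝ) / (numAut (Quot.out c).1 : ℝ)

/-! ## Local invariants -/

/-- `L_p` is isotropic. -/
def IsotropicP (p : ℕ) [Fact p.Prime] (A : TernMat) : Prop :=
  ∃ x : Fin 3 → ℤ_[p], x ≠ 0 ∧ quadVal (padicMat p A) x = 0

/-- The modified Hasse symbol `S_p*(L)`: `1` if `L_p` is isotropic, `-1` if anisotropic. -/
def SpStar (p : ℕ) (A : TernMat) : ℤ :=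
  if h : p.Prime then
    letI : Fact p.Prime := ⟨h⟩
    if IsotropicP p A then 1 else -1
  else 1

/-- The lattice is even: all represented numbers are even. -/
def IsEvenLat (A : TernMat) : Prop := ∀ x : Fin 3 → ℤ, 2 ∣ quadVal A x

/-- The lattice is primitive: its scale ideal is `ℤ`. -/
def IsPrimitiveLat (A : TernMat) : Prop :=
  Finset.univ.gcd (fun ij : Fin 3 × Fin 3 => (A ij.1 ij.2).natAbs) = 1

/-- Stability at a prime `p`. -/
def StableAt (A : TernMat) (p : ℕ) : Prop :=
  padicValInt p A.det ≤ 1 ∧ (p = 2 → (padicValInt 2 A.det = 1 ↔ IsEvenLat A))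

/-- A stable (primitive) ternary lattice. -/
def IsStable (A : TernMat) : Prop := IsPrimitiveLat A ∧ ∀ p : ℕ, p.Prime → StableAt A p

def RepresentedAt (p : ℕ) (hp : p.Prime) (n : ℤ) (A : TernMat) : Prop :=
  letI : Fact p.Prime := ⟨hp⟩
  ∃ x : Fin 3 → ℤ_[p], quadVal (padicMat p A) x = (n : ℤ_[p])

/-- `n` is represented by `L_p` for every prime `p`. -/
def LocallyRepresented (n : ℤ) (A : TernMat) : Prop :=
  ∀ (p : ℕ) (hp : p.Prime), RepresentedAt p hp n A

/-! ## Siegel local densities -/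

/-- The Siegel local density `α_p(n, L)` (here `s = 1`, `t = 3`). -/
def localDensity (p : ℕ) (hp : p.Prime) (n : ℤ) (A : TernMat) : ℝ :=
  limUnder atTop fun r : ℕ =>
    (Nat.card {X : Fin 3 → ZMod (p ^ r) //
        (∑ i, ∑ j, X i * (A i j : ZMod (p ^ r)) * X j) = (n : ZMod (p ^ r))} : ℝ) /
      (p : ℝ) ^ (2 * r)

def localDensityN (p : ℕ) (n : ℤ) (A : TernMat) : ℝ :=
  if h : p.Prime then localDensity p h n A else 0

/-- The value `L(1, χ_a)` of the Dirichlet series attached to the Kronecker symbol `(a/·)`. -/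
def LOne (a : ℤ) : ℝ :=
  limUnder atTop fun N : ℕ =>
    ∑ k ∈ Finset.range N, (kroneckerSym a (k + 1) : ℝ) / (k + 1)

/-! ## Watson transformations (Gram matrix form) -/

/-- The underlying set of `Λ_m(L)` in the coordinates of `L`. -/
def watsonSetG (m : ℕ) (A : TernMat) : Set (Fin 3 → ℤ) :=
  {x | ∀ y : Fin 3 → ℤ, (m : ℤ) ∣ (quadVal A (x + y) - quadVal A y)}

/-- `B` is a Gram matrix for the sublattice `Λ_m(L)` of the lattice `L` with Gram matrix `A`. -/
def IsWatsonGram (m : ℕ) (A B : TernMat) : Prop :=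
  ∃ T : TernMat, Set.range T.mulVec = watsonSetG m A ∧ B = Tᵀ * A * T

/-- `B` is a Gram matrix of the Watson transform `λ_m(L)`: the primitive rescaling of `Λ_m(L)`. -/
def IsLambdaGram (m : ℕ) (A B : TernMat) : Prop :=
  IsPrimitiveLat B ∧
    ∃ (B₀ : TernMat) (c : ℚ), 0 < c ∧ IsWatsonGram m A B₀ ∧
      B.map ((↑) : ℤ → ℚ) = c • B₀.map ((↑) : ℤ → ℚ)

/-- The `3×3` Gram matrix of the orthogonal sum `M ⊥ U`. -/
def blockMat3 {p : ℕ} [Fact p.Prime] (k : ℕ) (hk : k ≤ 3)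
    (M : Matrix (Fin k) (Fin k) ℤ_[p]) (U : Matrix (Fin (3 - k)) (Fin (3 - k)) ℤ_[p]) :
    Matrix (Fin 3) (Fin 3) ℤ_[p] :=
  Matrix.reindex (finSumFinEquiv.trans (finCongr (by omega)))
    (finSumFinEquiv.trans (finCongr (by omega))) (Matrix.fromBlocks M 0 0 U)

end
/-! ### Counting machinery -/

def QF (q : ℕ) (A : TernMat) (X : Fin 3 → ZMod q) : ZMod q :=
  ∑ i, ∑ j, X i * (A i j : ZMod q) * X j

def AXv (q : ℕ) (A : TernMat) (X : Fin 3 → ZMod q) (i : Fin 3) : ZMod q :=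
  ∑ j, (A i j : ZMod q) * X j

/-- number of solutions modulo `q` -/
noncomputable def NN (q : ℕ) (A : TernMat) (n : ℤ) : ℕ := Nat.card {X : Fin 3 → ZMod q // QF q A X = (n : ZMod q)}

/-- number of smooth solutions -/
noncomputable def GG (q : ℕ) (A : TernMat) (n : ℤ) : ℕ :=
  Nat.card {X : Fin 3 → ZMod q // QF q A X = (n : ZMod q) ∧ ∃ i, IsUnit (AXv q A X i)}

/-- number of singular solutions -/
noncomputable def SS (q : ℕ) (A : TernMat) (n : ℤ) : ℕ :=
  Nat.card {X : Fin 3 → ZMod q // QF q A X = (n : ZMod q) ∧ ¬ ∃ i, IsUnit (AXv q A X i)}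

theorem card_split {α : Type*} [Finite α] (P R : α → Prop) :
    Nat.card {x // P x} = Nat.card {x // P x ∧ R x} + Nat.card {x // P x ∧ ¬ R x} := by
  have := Fintype.ofFinite α
  simp only [Nat.card_eq_fintype_card, Fintype.card_subtype]
  rw [← Finset.filter_filter, ← Finset.filter_filter]
  exact (Finset.card_filter_add_card_filter_not _).symm

theorem NN_eq (q : ℕ) [NeZero q] (A : TernMat) (n : ℤ) : NN q A n = GG q A n + SS q A n :=
  card_split _ _

theorem card_hom_fiber {G H : Type*} [AddCommGroup G] [AddCommGroup H] [Finite G] [Finite H]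
    (f : G →+ H) (P : H → Prop) :
    Nat.card {g // P (f g)} = Nat.card {h // P h ∧ h ∈ Set.range f} * Nat.card {g // f g = 0} := by
  have e : {g // P (f g)} ≃ Σ h : {h // P h ∧ h ∈ Set.range f}, {g // f g = h.1} :=
    { toFun := fun g => ⟨⟨f g.1, g.2, g.1, rfl⟩, ⟨g.1, rfl⟩⟩
      invFun := fun x => ⟨x.2.1, by rw [x.2.2]; exact x.1.2.1⟩
      left_inv := fun g => rfl
      right_inv := by
        rintro ⟨⟨h, h1, h2⟩, ⟨g, hg⟩⟩
        dsimp at hg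
        subst hg
        rfl }
  have := Fintype.ofFinite {h // P h ∧ h ∈ Set.range f}
  rw [Nat.card_congr e, Nat.card_sigma]
  rw [Finset.sum_congr rfl (g := fun _ => Nat.card {g // f g = 0})]
  · rw [Finset.sum_const, Finset.card_univ, smul_eq_mul,
      Nat.card_eq_fintype_card (α := {h // P h ∧ h ∈ Set.range f})]
  · rintro ⟨h, h1, g0, hg0⟩ _
    refine Nat.card_congr
      { toFun := fun g => ⟨g.1 - g0, by rw [map_sub, g.2, hg0]; simp⟩
        invFun := fun g => ⟨g.1 + g0, by rw [map_add, g.2, hg0]; simp⟩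
        left_inv := fun g => by simp
        right_inv := fun g => by simp }

theorem card_p_ker (p : ℕ) (hp : p.Prime) (s : ℕ) :
    Nat.card {c : ZMod (p ^ (s + 1)) // (p : ZMod (p ^ (s + 1))) * c = 0} = p := by
  have : NeZero (p ^ (s + 1)) := ⟨pow_ne_zero _ hp.ne_zero⟩
  have := IsAddCyclic.card_nsmulAddMonoidHom_ker (G := ZMod (p ^ (s + 1))) p
  rw [Nat.card_zmod, Nat.gcd_eq_right (dvd_pow_self p (by omega))] at this
  refine Eq.trans ?_ this
  refine Nat.card_congr (Equiv.subtypeEquivRight fun c => ?_)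
  rw [AddMonoidHom.mem_ker]
  simp

/-- coordinatewise reduction -/
def redHom (q q' : ℕ) (h : q' ∣ q) : (Fin 3 → ZMod q) →+ (Fin 3 → ZMod q') where
  toFun X i := ZMod.castHom h (ZMod q') (X i)
  map_zero' := by ext; simp
  map_add' X Y := by ext i; exact map_add (ZMod.castHom h (ZMod q')) (X i) (Y i)

theorem redHom_surj (q q' : ℕ) (h : q' ∣ q) : Function.Surjective (redHom q q' h) := by
  intro Y
  choose X hX using fun i => ZMod.castHom_surjective h (Y i)
  exact ⟨X, funext hX⟩

theorem QF_red (q q' : ℕ) (h : q' ∣ q) (A : TernMat) (X) :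
    QF q' A (redHom q q' h X) = ZMod.castHom h (ZMod q') (QF q A X) := by
  unfold QF redHom
  simp only [AddMonoidHom.coe_mk, ZeroHom.coe_mk, map_sum, map_mul, map_intCast]

theorem AXv_red (q q' : ℕ) (h : q' ∣ q) (A : TernMat) (X i) :
    AXv q' A (redHom q q' h X) i = ZMod.castHom h (ZMod q') (AXv q A X i) := by
  unfold AXv redHom
  simp only [AddMonoidHom.coe_mk, ZeroHom.coe_mk, map_sum, map_mul, map_intCast]

theorem card_red (p : ℕ) (hp : p.Prime) (s k : ℕ) (P : (Fin 3 → ZMod (p ^ s)) → Prop) :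
    Nat.card {X // P (redHom (p ^ (s + k)) (p ^ s) (pow_dvd_pow p (by omega)) X)} =
      p ^ (3 * k) * Nat.card {Y // P Y} := by
  have : NeZero (p ^ (s + k)) := ⟨pow_ne_zero _ hp.ne_zero⟩
  have : NeZero (p ^ s) := ⟨pow_ne_zero _ hp.ne_zero⟩
  set f := redHom (p ^ (s + k)) (p ^ s) (pow_dvd_pow p (by omega)) with hf
  have hs : Function.Surjective f := redHom_surj _ _ _
  have h1 := card_hom_fiber f (fun _ => True)
  have h2 := card_hom_fiber f P
  simp only [hs.range_eq, Set.mem_univ, and_true] at h1 h2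
  rw [h2]
  simp only [Nat.card_congr (Equiv.subtypeUnivEquiv (fun _ => trivial))] at h1
  simp only [Nat.card_pi, Nat.card_zmod, Finset.prod_const, Finset.card_univ, Fintype.card_fin] at h1
  have : Nat.card {g // f g = 0} = p ^ (3 * k) := by
    have h0 : 0 < (p ^ s) ^ 3 := pow_pos (pow_pos hp.pos _) _
    apply Nat.eq_of_mul_eq_mul_left h0
    rw [← h1]; ring
  rw [this, mul_comm]

theorem isUnit_iff_red (p : ℕ) (hp : p.Prime) (s : ℕ) (x : ZMod (p ^ (s + 1))) :
    IsUnit x ↔ ZMod.castHom (dvd_pow_self p (Nat.succ_ne_zero s)) (ZMod p) x ≠ 0 := by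
  have : NeZero (p ^ (s + 1)) := ⟨pow_ne_zero _ hp.ne_zero⟩
  obtain ⟨m, rfl⟩ := ZMod.natCast_zmod_surjective x
  rw [ZMod.isUnit_iff_coprime, map_natCast, Ne, ZMod.natCast_eq_zero_iff,
    Nat.coprime_pow_right_iff (by omega), Nat.coprime_comm, hp.coprime_iff_not_dvd]

theorem dvd_iff_red (p : ℕ) (hp : p.Prime) (s : ℕ) (x : ZMod (p ^ (s + 1))) :
    ZMod.castHom (dvd_pow_self p (Nat.succ_ne_zero s)) (ZMod p) x = 0 ↔
      ∃ y, (p : ZMod (p ^ (s + 1))) * y = x := by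
  have : NeZero (p ^ (s + 1)) := ⟨pow_ne_zero _ hp.ne_zero⟩
  constructor
  · obtain ⟨m, rfl⟩ := ZMod.natCast_zmod_surjective x
    rw [map_natCast, ZMod.natCast_eq_zero_iff]
    rintro ⟨c, rfl⟩
    exact ⟨c, by push_cast; rfl⟩
  · rintro ⟨y, rfl⟩
    simp

/-- `p^k * x = p^k * y` modulo `p^(s+k)` iff `x = y` modulo `p^s` -/
theorem mul_pow_eq_iff (p : ℕ) (hp : p.Prime) (s k : ℕ) (x y : ZMod (p ^ (s + k))) :
    (p : ZMod (p ^ (s + k))) ^ k * x = (p : ZMod (p ^ (s + k))) ^ k * y ↔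
      ZMod.castHom (pow_dvd_pow p (Nat.le_add_right s k)) (ZMod (p ^ s)) x =
      ZMod.castHom (pow_dvd_pow p (Nat.le_add_right s k)) (ZMod (p ^ s)) y := by
  have : NeZero (p ^ (s + k)) := ⟨pow_ne_zero _ hp.ne_zero⟩
  obtain ⟨m, rfl⟩ := ZMod.intCast_surjective x
  obtain ⟨l, rfl⟩ := ZMod.intCast_surjective y
  rw [map_intCast, map_intCast]
  have h1 := ZMod.intCast_eq_intCast_iff_dvd_sub ((p : ℤ) ^ k * m) ((p : ℤ) ^ k * l) (p ^ (s + k))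
  push_cast at h1
  rw [h1, ZMod.intCast_eq_intCast_iff_dvd_sub, ← mul_sub, pow_add, mul_comm]
  push_cast
  exact mul_dvd_mul_iff_left (pow_ne_zero _ (by exact_mod_cast hp.ne_zero))


/-! ### Hensel lifting of smooth solutions -/

theorem QF_add_single (q : ℕ) (A : TernMat) (hA : A.IsSymm) (X : Fin 3 → ZMod q) (i : Fin 3)
    (t : ZMod q) :
    QF q A (X + Pi.single i t) = QF q A X + 2 * t * AXv q A X i + (A i i : ZMod q) * t ^ 2 := by
  have h1 := hA.apply 0 1
  have h2 := hA.apply 0 2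
  have h3 := hA.apply 1 2
  unfold QF AXv
  fin_cases i <;> simp [Fin.sum_univ_three, h1, h2, h3] <;> ring

theorem AXv_add_single (q : ℕ) (A : TernMat) (X : Fin 3 → ZMod q) (i j : Fin 3)
    (t : ZMod q) :
    AXv q A (X + Pi.single i t) j = AXv q A X j + A j i * t := by
  unfold AXv
  fin_cases i <;> simp [Fin.sum_univ_three] <;> ring

noncomputable def idx (P : Fin 3 → Prop) : Fin 3 := if h : ∃ i, P i then h.choose else 0

theorem idx_spec (P : Fin 3 → Prop) (h : ∃ i, P i) : P (idx P) := by
  unfold idx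
  rw [dif_pos h]
  exact h.choose_spec

noncomputable def shiftT (q : ℕ) (A : TernMat) (c : ZMod q) (X : Fin 3 → ZMod q) : ZMod q :=
  c * (2 * AXv q A X (idx fun i => IsUnit (AXv q A X i)))⁻¹

noncomputable def shiftV (q : ℕ) (A : TernMat) (c : ZMod q) (X : Fin 3 → ZMod q) :
    Fin 3 → ZMod q :=
  X + Pi.single (idx fun i => IsUnit (AXv q A X i)) (shiftT q A c X)

theorem small_facts (p : ℕ) (hp : p.Prime) (s : ℕ) (c : ZMod (p ^ (s + 2)))
    (hc : (p : ZMod (p ^ (s + 2))) * c = 0) :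
    c * c = 0 ∧ ZMod.castHom (dvd_pow_self p (Nat.succ_ne_zero (s + 1))) (ZMod p) c = 0 := by
  have : NeZero (p ^ (s + 2)) := ⟨pow_ne_zero _ hp.ne_zero⟩
  have h0 : ZMod.castHom (dvd_pow_self p (Nat.succ_ne_zero (s + 1))) (ZMod p) c = 0 := by
    by_contra h
    have hu : IsUnit c := (isUnit_iff_red p hp (s + 1) c).2 h
    have h1 : (p : ZMod (p ^ (s + 2))) = 0 := hu.mul_left_eq_zero.1 hc
    rw [ZMod.natCast_eq_zero_iff] at h1
    have h2 := Nat.le_of_dvd hp.pos h1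
    have h3 : p ^ 1 < p ^ (s + 2) := Nat.pow_lt_pow_right hp.one_lt (by omega)
    simp at h3
    omega
  refine ⟨?_, h0⟩
  obtain ⟨y, rfl⟩ := (dvd_iff_red p hp (s + 1) c).1 h0
  linear_combination y * hc

theorem shift_facts (p : ℕ) (hp : p.Prime) (hp2 : p ≠ 2) (s : ℕ) (A : TernMat) (hA : A.IsSymm)
    (c : ZMod (p ^ (s + 2))) (hc : (p : ZMod (p ^ (s + 2))) * c = 0) (X)
    (hX : ∃ i, IsUnit (AXv (p ^ (s + 2)) A X i)) :
    QF _ A (shiftV _ A c X) = QF _ A X + c ∧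
    (∃ i, IsUnit (AXv (p ^ (s + 2)) A (shiftV _ A c X) i)) ∧
    shiftV _ A (-c) (shiftV _ A c X) = X := by
  have : NeZero (p ^ (s + 2)) := ⟨pow_ne_zero _ hp.ne_zero⟩
  obtain ⟨hcc, hc0⟩ := small_facts p hp s c hc
  have h2 : IsUnit (2 : ZMod (p ^ (s + 2))) := by
    have := (ZMod.isUnit_iff_coprime 2 (p ^ (s + 2))).2
      (Nat.Coprime.pow_right _ ((Nat.coprime_primes Nat.prime_two hp).2 (Ne.symm hp2)))
    exact_mod_cast this
  have hi := idx_spec _ hX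
  have hpred : (fun i => IsUnit (AXv (p ^ (s + 2)) A (shiftV _ A c X) i)) =
      (fun i => IsUnit (AXv (p ^ (s + 2)) A X i)) := by
    funext j
    unfold shiftV
    rw [AXv_add_single, isUnit_iff_red p hp (s + 1), isUnit_iff_red p hp (s + 1)]
    unfold shiftT
    rw [map_add, map_mul, map_mul, hc0]
    simp
  have hi' : IsUnit (AXv (p ^ (s + 2)) A (shiftV _ A c X)
      (idx fun i => IsUnit (AXv (p ^ (s + 2)) A X i))) := by
    have := idx_spec _ (show ∃ i, (fun i => IsUnit (AXv (p ^ (s + 2)) A (shiftV _ A c X) i)) i by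
      rw [hpred]; exact hX)
    rw [hpred] at this
    exact (congrFun hpred _).mpr hi
  have e1 := ZMod.mul_inv_of_unit _ (h2.mul hi)
  have e2 := ZMod.mul_inv_of_unit _ (h2.mul hi')
  have e3 : shiftT _ A (-c) (shiftV _ A c X) = - shiftT _ A c X := by
    have e4 : shiftT _ A (-c) (shiftV _ A c X) = -c * (2 * AXv (p ^ (s + 2)) A (shiftV _ A c X)
      (idx fun i => IsUnit (AXv (p ^ (s + 2)) A X i)))⁻¹ := by
      conv_lhs => unfold shiftT
      rw [hpred]
    rw [e4]
    have e5 : AXv (p ^ (s + 2)) A (shiftV _ A c X) (idx fun i => IsUnit (AXv (p ^ (s + 2)) A X i)) =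
      AXv (p ^ (s + 2)) A X (idx fun i => IsUnit (AXv (p ^ (s + 2)) A X i)) + _ :=
      AXv_add_single _ _ _ _ _ _
    unfold shiftT at e5 ⊢
    generalize (2 * AXv (p ^ (s + 2)) A (shiftV _ A c X)
      (idx fun i => IsUnit (AXv (p ^ (s + 2)) A X i)))⁻¹ = b' at *
    generalize (2 * AXv (p ^ (s + 2)) A X
      (idx fun i => IsUnit (AXv (p ^ (s + 2)) A X i)))⁻¹ = b at *
    generalize AXv (p ^ (s + 2)) A (shiftV _ A c X)
      (idx fun i => IsUnit (AXv (p ^ (s + 2)) A X i)) = a' at *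
    generalize AXv (p ^ (s + 2)) A X
      (idx fun i => IsUnit (AXv (p ^ (s + 2)) A X i)) = a at *
    generalize ((A (idx fun i => IsUnit (AXv (p ^ (s + 2)) A X i)) (idx fun i => IsUnit (AXv (p ^ (s + 2)) A X i)) : ℤ) : ZMod (p ^ (s + 2))) = d at *
    -- c b = c b (2 a') b' ; c b (2 a) b' = c b'
    subst e5
    linear_combination (c * b') * e1 - (c * b) * e2 + (2 * d * b * b * b') * hcc
  refine ⟨?_, ⟨_, hi'⟩, ?_⟩
  · unfold shiftV
    rw [QF_add_single _ _ hA]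
    unfold shiftT
    generalize (2 * AXv (p ^ (s + 2)) A X
      (idx fun i => IsUnit (AXv (p ^ (s + 2)) A X i)))⁻¹ = b at *
    linear_combination c * e1 + (b ^ 2 * (A (idx fun i => IsUnit (AXv (p ^ (s + 2)) A X i)) (idx fun i => IsUnit (AXv (p ^ (s + 2)) A X i)) : ZMod (p ^ (s + 2)))) * hcc
  · have : shiftV _ A (-c) (shiftV _ A c X) = shiftV _ A c X +
      Pi.single (idx fun i => IsUnit (AXv (p ^ (s + 2)) A X i)) (- shiftT _ A c X) := by
      conv_lhs => unfold shiftV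
      rw [← e3]
      change shiftV _ A c X + Pi.single (idx fun i => IsUnit (AXv (p ^ (s + 2)) A (shiftV _ A c X) i)) _ = _
      rw [hpred]
      rfl
    rw [this]
    conv_lhs => unfold shiftV
    rw [add_assoc, ← Pi.single_add]
    simp

theorem hensel_step (p : ℕ) (hp : p.Prime) (hp2 : p ≠ 2) (s : ℕ) (A : TernMat) (hA : A.IsSymm)
    (n : ℤ) : GG (p ^ (s + 2)) A n = p ^ 2 * GG (p ^ (s + 1)) A n := by
  have : NeZero (p ^ (s + 2)) := ⟨pow_ne_zero _ hp.ne_zero⟩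
  have : NeZero (p ^ (s + 1)) := ⟨pow_ne_zero _ hp.ne_zero⟩
  have h1 := card_red p hp (s + 1) 1 (fun X => QF (p ^ (s + 1)) A X = (n : ZMod (p ^ (s + 1))) ∧
    ∃ i, IsUnit (AXv (p ^ (s + 1)) A X i))
  have h2 : Nat.card {X : Fin 3 → ZMod (p ^ (s + 2)) //
      (p : ZMod (p ^ (s + 2))) * (QF _ A X - n) = 0 ∧ ∃ i, IsUnit (AXv (p ^ (s + 2)) A X i)} =
      p ^ 3 * GG (p ^ (s + 1)) A n := by
    refine Eq.trans ?_ h1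
    refine Nat.card_congr (Equiv.subtypeEquivRight fun X => ?_)
    refine and_congr ?_ (exists_congr fun i => ?_)
    · have := mul_pow_eq_iff p hp (s + 1) 1 (QF _ A X) n
      rw [QF_red]
      rw [map_intCast, pow_one] at this
      rw [← this, mul_sub, sub_eq_zero]
    · rw [AXv_red, isUnit_iff_red p hp s, isUnit_iff_red p hp (s + 1)]
      have : ∀ x : ZMod (p ^ (s + 2)), ZMod.castHom (dvd_pow_self p (Nat.succ_ne_zero s)) (ZMod p)
        (ZMod.castHom (pow_dvd_pow p (by omega : s + 1 ≤ s + 1 + 1)) (ZMod (p ^ (s + 1))) x) =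
        ZMod.castHom (dvd_pow_self p (Nat.succ_ne_zero (s + 1))) (ZMod p) x := by
        intro x
        obtain ⟨m, rfl⟩ := ZMod.intCast_surjective x
        rw [map_intCast, map_intCast]
        exact (map_intCast (ZMod.castHom (dvd_pow_self p (Nat.succ_ne_zero (s + 1))) (ZMod p)) m).symm
      rw [← this]
  have h3 : Nat.card {X : Fin 3 → ZMod (p ^ (s + 2)) //
      (p : ZMod (p ^ (s + 2))) * (QF _ A X - n) = 0 ∧ ∃ i, IsUnit (AXv (p ^ (s + 2)) A X i)} =
      Nat.card ({c : ZMod (p ^ (s + 2)) // (p : ZMod (p ^ (s + 2))) * c = 0} ×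
      {X : Fin 3 → ZMod (p ^ (s + 2)) // QF _ A X = n ∧ ∃ i, IsUnit (AXv (p ^ (s + 2)) A X i)}) := by
    refine Nat.card_congr
     { toFun := fun X => ⟨⟨QF _ A X.1 - n, X.2.1⟩, ⟨shiftV _ A (-(QF _ A X.1 - n)) X.1, ?_⟩⟩
       invFun := fun Y => ⟨shiftV _ A Y.1.1 Y.2.1, ?_⟩
       left_inv := ?_
       right_inv := ?_ }
    · have := shift_facts p hp hp2 s A hA (-(QF _ A X.1 - n))
        (by rw [mul_neg, X.2.1, neg_zero]) X.1 X.2.2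
      refine ⟨?_, this.2.1⟩
      rw [this.1]; ring
    · have := shift_facts p hp hp2 s A hA Y.1.1 Y.1.2 Y.2.1 Y.2.2.2
      refine ⟨?_, this.2.1⟩
      rw [this.1, Y.2.2.1]
      rw [add_sub_cancel_left]
      exact Y.1.2
    · rintro ⟨X, hX1, hX2⟩
      have := shift_facts p hp hp2 s A hA (-(QF _ A X - n))
        (by rw [mul_neg, hX1, neg_zero]) X hX2
      ext1
      simpa only [neg_neg] using this.2.2
    · rintro ⟨⟨c, hc⟩, ⟨X, hX1, hX2⟩⟩
      have := shift_facts p hp hp2 s A hA c hc X hX2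
      have e : QF _ A (shiftV _ A c X) - n = c := by rw [this.1, hX1]; ring
      ext1
      · ext1; exact e
      · ext1
        dsimp only
        rw [e]
        exact this.2.2
  rw [h3, Nat.card_prod] at h2
  have h4 := card_p_ker p hp (s + 1)
  change Nat.card {c : ZMod (p ^ (s + 2)) // (p : ZMod (p ^ (s + 2))) * c = 0} = p at h4
  rw [h4] at h2
  apply Nat.eq_of_mul_eq_mul_left hp.pos
  calc p * GG (p ^ (s + 2)) A n = p ^ 3 * GG (p ^ (s + 1)) A n := h2
    _ = _ := by ring

theorem GG_eq (p : ℕ) (hp : p.Prime) (hp2 : p ≠ 2) (s : ℕ) (A : TernMat) (hA : A.IsSymm)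
    (n : ℤ) : GG (p ^ (s + 1)) A n = p ^ (2 * s) * GG p A n := by
  induction s with
  | zero => simp
  | succ s ih => rw [hensel_step p hp hp2 s A hA n, ih]; ring

/-! ### Singular solutions -/

def dHom (q : ℕ) (d : Fin 3 → ℕ) : (Fin 3 → ZMod q) →+ (Fin 3 → ZMod q) where
  toFun X i := (d i : ZMod q) * X i
  map_zero' := by ext; simp
  map_add' X Y := by ext i; exact mul_add _ _ _

theorem QF_dHom (q : ℕ) (A B : TernMat) (d : Fin 3 → ℕ) (c : ℤ)
    (h : ∀ i j, (d i : ℤ) * A i j * d j = c * B i j) (X) :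
    QF q A (dHom q d X) = c * QF q B X := by
  unfold QF dHom
  simp only [AddMonoidHom.coe_mk, ZeroHom.coe_mk, Finset.mul_sum]
  refine Finset.sum_congr rfl fun i _ => Finset.sum_congr rfl fun j _ => ?_
  have := congrArg (Int.cast : ℤ → ZMod q) (h i j)
  push_cast at this
  linear_combination X i * X j * this

theorem sing_iff (p : ℕ) (hp : p.Prime) (t : ℕ) (A : TernMat) (d : Fin 3 → ℕ)
    (hd : ∀ i, d i = 1 ∨ d i = p)
    (hNS : ∀ x : Fin 3 → ZMod p, (∀ i, AXv p A x i = 0) ↔ ∀ i, d i = p → x i = 0) (X) :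
    (¬ ∃ i, IsUnit (AXv (p ^ (t + 1)) A X i)) ↔ X ∈ Set.range (dHom (p ^ (t + 1)) d) := by
  have h1 : (¬ ∃ i, IsUnit (AXv (p ^ (t + 1)) A X i)) ↔
      ∀ i, AXv p A (redHom _ p (dvd_pow_self p (Nat.succ_ne_zero t)) X) i = 0 := by
    push Not
    refine forall_congr' fun i => ?_
    rw [isUnit_iff_red p hp t, AXv_red]
    simp only [ne_eq, not_not]
  rw [h1, hNS]
  constructor
  · intro h
    have : ∀ i, ∃ y, (d i : ZMod (p ^ (t + 1))) * y = X i := by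
      intro i
      rcases hd i with h0 | h0
      · exact ⟨X i, by rw [h0]; simp⟩
      · rw [h0]
        exact (dvd_iff_red p hp t (X i)).1 (h i h0)
    choose Y hY using this
    exact ⟨Y, funext hY⟩
  · rintro ⟨Y, rfl⟩ i hi
    refine (dvd_iff_red p hp t _).2 ⟨Y i, ?_⟩
    change _ = (d i : ZMod (p ^ (t + 1))) * Y i
    rw [hi]

theorem card_dHom_ker (p : ℕ) (hp : p.Prime) (t : ℕ) (d : Fin 3 → ℕ)
    (hd : ∀ i, d i = 1 ∨ d i = p) :
    Nat.card {X // dHom (p ^ (t + 1)) d X = 0} = ∏ i, d i := by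
  have e : {X // dHom (p ^ (t + 1)) d X = 0} ≃
      ((i : Fin 3) → {x : ZMod (p ^ (t + 1)) // (d i : ZMod (p ^ (t + 1))) * x = 0}) :=
    { toFun := fun X i => ⟨X.1 i, congrFun X.2 i⟩
      invFun := fun Y => ⟨fun i => (Y i).1, funext fun i => (Y i).2⟩
      left_inv := fun X => rfl
      right_inv := fun Y => rfl }
  rw [Nat.card_congr e, Nat.card_pi]
  refine Finset.prod_congr rfl fun i _ => ?_
  rcases hd i with h0 | h0
  · rw [h0]; simp
  · rw [h0]; exact card_p_ker p hp t

theorem SS_eq (p : ℕ) (hp : p.Prime) (s k t : ℕ) (ht : s + k = t + 1) (A B : TernMat)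
    (d : Fin 3 → ℕ) (hd : ∀ i, d i = 1 ∨ d i = p)
    (hNS : ∀ x : Fin 3 → ZMod p, (∀ i, AXv p A x i = 0) ↔ ∀ i, d i = p → x i = 0)
    (h : ∀ i j, (d i : ℤ) * A i j * d j = (p : ℤ) ^ k * B i j) (n : ℤ) :
    SS (p ^ (s + k)) A ((p : ℤ) ^ k * n) * ∏ i, d i = p ^ (3 * k) * NN (p ^ s) B n := by
  have : NeZero (p ^ (s + k)) := ⟨pow_ne_zero _ hp.ne_zero⟩
  have h1 := card_red p hp s k (fun X => QF (p ^ s) B X = (n : ZMod (p ^ s)))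
  unfold NN
  rw [← h1]
  have h2 := card_hom_fiber (dHom (p ^ (s + k)) d)
    (fun X => QF (p ^ (s + k)) A X = (((p : ℤ) ^ k * n : ℤ) : ZMod (p ^ (s + k))))
  have h3 : Nat.card {X // dHom (p ^ (s + k)) d X = 0} = ∏ i, d i := by
    rw [ht]; exact card_dHom_ker p hp t d hd
  rw [h3] at h2
  have h4 : SS (p ^ (s + k)) A ((p : ℤ) ^ k * n) = Nat.card {X // QF (p ^ (s + k)) A X =
      (((p : ℤ) ^ k * n : ℤ) : ZMod (p ^ (s + k))) ∧ X ∈ Set.range (dHom (p ^ (s + k)) d)} := by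
    refine Nat.card_congr (Equiv.subtypeEquivRight fun X => and_congr_right fun _ => ?_)
    revert X
    rw [ht]
    exact fun X _ => sing_iff p hp t A d hd hNS X
  rw [h4, ← h2]
  refine Nat.card_congr (Equiv.subtypeEquivRight fun X => ?_)
  rw [QF_dHom _ A B d _ h, QF_red]
  have := mul_pow_eq_iff p hp s k (QF _ B X) n
  rw [map_intCast] at this
  rw [← this]
  push_cast
  rfl

theorem SS_zero (p : ℕ) (hp : p.Prime) (r k m : ℕ) (hr : r ≠ 0) (A B : TernMat)
    (d : Fin 3 → ℕ) (hd : ∀ i, d i = 1 ∨ d i = p)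
    (hNS : ∀ x : Fin 3 → ZMod p, (∀ i, AXv p A x i = 0) ↔ ∀ i, d i = p → x i = 0)
    (h : ∀ i j, (d i : ℤ) * A i j * d j = (p : ℤ) ^ k * B i j) (n : ℤ)
    (hmk : m ≤ k) (hmr : m ≤ r) (hm : ¬ (p : ℤ) ^ m ∣ n) :
    SS (p ^ r) A n = 0 := by
  obtain ⟨t, rfl⟩ := Nat.exists_eq_succ_of_ne_zero hr
  unfold SS
  rw [Nat.card_eq_zero]
  left
  constructor
  rintro ⟨X, hX, hs⟩
  obtain ⟨Y, rfl⟩ := (sing_iff p hp t A d hd hNS X).1 hs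
  rw [QF_dHom _ A B d _ h] at hX
  have := congrArg (ZMod.castHom (pow_dvd_pow p hmr) (ZMod (p ^ m))) hX
  rw [map_mul, map_intCast, map_intCast] at this
  have h0 : (((p : ℤ) ^ k : ℤ) : ZMod (p ^ m)) = 0 := by
    rw [ZMod.intCast_zmod_eq_zero_iff_dvd]
    push_cast
    exact pow_dvd_pow _ hmk
  rw [h0, zero_mul, eq_comm, ZMod.intCast_zmod_eq_zero_iff_dvd] at this
  push_cast at this
  exact hm this

/-! ### Counting over finite fields -/

theorem quadVal_eq {R : Type*} [CommRing R] {k : ℕ} (M : Matrix (Fin k) (Fin k) R)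
    (x : Fin k → R) : quadVal M x = x ⬝ᵥ (M *ᵥ x) := by
  unfold quadVal dotProduct mulVec dotProduct
  refine Finset.sum_congr rfl fun i _ => ?_
  rw [Finset.mul_sum]
  exact Finset.sum_congr rfl fun j _ => by ring

theorem quadVal_congr {R : Type*} [CommRing R] {k : ℕ} (M U : Matrix (Fin k) (Fin k) R)
    (x : Fin k → R) : quadVal (Uᵀ * M * U) x = quadVal M (U *ᵥ x) := by
  rw [quadVal_eq, quadVal_eq, ← Matrix.mulVec_mulVec, ← Matrix.mulVec_mulVec,
    Matrix.dotProduct_mulVec, Matrix.vecMul_transpose]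

theorem card_congr_quadVal {R : Type*} [CommRing R] {k : ℕ} (M U : Matrix (Fin k) (Fin k) R)
    (hU : IsUnit U.det) (t : R) :
    Nat.card {x // quadVal (Uᵀ * M * U) x = t} = Nat.card {x // quadVal M x = t} := by
  refine Nat.card_congr
    { toFun := fun x => ⟨U *ᵥ x.1, by rw [← quadVal_congr]; exact x.2⟩
      invFun := fun x => ⟨U⁻¹ *ᵥ x.1, ?_⟩
      left_inv := fun x => ?_
      right_inv := fun x => ?_ }
  · rw [quadVal_congr, Matrix.mulVec_mulVec, Matrix.mul_nonsing_inv _ hU, Matrix.one_mulVec]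
    exact x.2
  · ext1; simp only [Matrix.mulVec_mulVec, Matrix.nonsing_inv_mul _ hU, Matrix.one_mulVec]
  · ext1; simp only [Matrix.mulVec_mulVec, Matrix.mul_nonsing_inv _ hU, Matrix.one_mulVec]

theorem exists_diag {F : Type*} [Field F] (h2 : (2 : F) ≠ 0) {k : ℕ} (M : Matrix (Fin k) (Fin k) F)
    (hM : M.IsSymm) : ∃ (U : Matrix (Fin k) (Fin k) F) (w : Fin k → F), IsUnit U.det ∧
      Uᵀ * M * U = Matrix.diagonal w := by
  letI : Invertible (2 : F) := invertibleOfNonzero h2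
  have hs : LinearMap.IsSymm (Matrix.toBilin' M) := by
    refine ⟨fun x y => ?_⟩
    simp only [Matrix.toBilin'_apply', RingHom.id_apply]
    rw [Matrix.dotProduct_mulVec, dotProduct_comm, ← Matrix.mulVec_transpose, hM.eq]
  obtain ⟨v, hv⟩ := LinearMap.BilinForm.exists_orthogonal_basis hs
  have hfr : Module.finrank F (Fin k → F) = k := by simp
  let v' := v.reindex (finCongr hfr)
  have hv' : ∀ i j, i ≠ j → Matrix.toBilin' M (v' i) (v' j) = 0 := by
    intro i j hij
    simp only [v', Module.Basis.reindex_apply]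
    exact hv (fun h => hij ((finCongr hfr).symm.injective h))
  let U : Matrix (Fin k) (Fin k) F := (Pi.basisFun F (Fin k)).toMatrix v'
  have hU : ∀ i j, U i j = v' j i := fun i j => by simp [U, Module.Basis.toMatrix_apply]
  refine ⟨U, fun i => (Uᵀ * M * U) i i, ?_, ?_⟩
  · have := (Pi.basisFun F (Fin k)).invertibleToMatrix v'
    exact Matrix.isUnit_det_of_invertible _
  · ext i j
    by_cases hij : i = j
    · subst hij; simp
    · rw [Matrix.diagonal_apply_ne _ hij, ← hv' i j hij, Matrix.toBilin'_apply']
      rw [Matrix.mul_assoc]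
      simp only [Matrix.mul_apply, Matrix.transpose_apply, hU, dotProduct, mulVec]

section FF
variable {F : Type*} [Field F] [Fintype F]

theorem card_eq_sum_ind {α : Type*} [Fintype α] (P : α → Prop) :
    (Nat.card {x // P x} : ℤ) = ∑ x, if P x then 1 else 0 := by
  rw [Nat.card_eq_fintype_card, Fintype.card_subtype]
  simp

theorem ind1 (hF : ringChar F ≠ 2) (a t : F) (ha : a ≠ 0) :
    (∑ x : F, if a * x ^ 2 = t then (1 : ℤ) else 0) = 1 + quadraticChar F (a * t) := by
  have h := quadraticChar_card_sqrts hF (t / a)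
  have h1 : quadraticChar F (a * t) = quadraticChar F (t / a) := by
    have : a * t = a ^ 2 * (t / a) := by field_simp
    rw [this, map_mul, quadraticChar_sq_one' ha, one_mul]
  rw [h1, add_comm, ← h]
  simp only [Finset.sum_boole, Set.toFinset_ofPred]
  congr 2
  ext x
  simp only [Finset.mem_filter, Finset.mem_univ, true_and]
  rw [eq_div_iff ha, mul_comm]

theorem sum_sq (hF : ringChar F ≠ 2) (g : F → ℤ) :
    ∑ y : F, g (y ^ 2) = ∑ s : F, (1 + quadraticChar F s) * g s := by
  have : ∀ y : F, g (y ^ 2) = ∑ s : F, (if 1 * y ^ 2 = s then 1 else 0) * g s := by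
    intro y; simp
  simp_rw [this]
  rw [Finset.sum_comm]
  refine Finset.sum_congr rfl fun s _ => ?_
  rw [← Finset.sum_mul, ind1 hF 1 s one_ne_zero, one_mul]

theorem sum_chi_lin (hF : ringChar F ≠ 2) (a b : F) (hb : b ≠ 0) :
    ∑ s : F, quadraticChar F (a + b * s) = 0 := by
  rw [← quadraticChar_sum_zero hF]
  exact Fintype.sum_bijective (fun s => a + b * s)
    ((Equiv.mulLeft₀ b hb).trans (Equiv.addLeft a)).bijective _ _ (fun _ => rfl)

theorem sum_chi_chi (hF : ringChar F ≠ 2) (a b : F) (hb : b ≠ 0) :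
    ∑ s : F, quadraticChar F s * quadraticChar F (a + b * s) =
      if a = 0 then ((Fintype.card F : ℤ) - 1) * quadraticChar F b else - quadraticChar F b := by
  split_ifs with h
  · subst h
    have : ∀ s : F, quadraticChar F s * quadraticChar F (0 + b * s) =
        quadraticChar F b * (if s = 0 then 0 else 1) := by
      intro s
      split_ifs with hs
      · simp [hs]
      · rw [zero_add, map_mul]
        linear_combination quadraticChar F b * quadraticChar_sq_one hs
    simp_rw [this]
    rw [← Finset.mul_sum, mul_comm]
    congr 1
    rw [Finset.sum_ite]
    simp [Finset.filter_ne', Finset.card_univ]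
    rw [Nat.cast_sub Fintype.card_pos]; simp
  · have hJ := jacobiSum_nontrivial_inv (quadraticChar_ne_one hF)
    rw [(quadraticChar_isQuadratic F).inv] at hJ
    unfold jacobiSum at hJ
    have hc : -(a / b) ≠ 0 := neg_ne_zero.2 (div_ne_zero h hb)
    have : ∑ s : F, quadraticChar F s * quadraticChar F (a + b * s) =
       ∑ u : F, quadraticChar F (-(a / b) * u) * quadraticChar F (a + b * (-(a / b) * u)) :=
      (Fintype.sum_bijective (fun s => -(a / b) * s)
        (Equiv.mulLeft₀ _ hc).bijective _ _ (fun _ => rfl)).symm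
    rw [this]
    have h2 : ∀ u : F, quadraticChar F (-(a / b) * u) * quadraticChar F (a + b * (-(a / b) * u)) =
        quadraticChar F (-b) * (quadraticChar F u * quadraticChar F (1 - u)) := by
      intro u
      rw [← map_mul, ← map_mul, ← map_mul]
      have : -(a / b) * u * (a + b * (-(a / b) * u)) = (a / b) ^ 2 * (-b * (u * (1 - u))) := by
        field_simp; ring
      rw [this, map_mul, quadraticChar_sq_one' (div_ne_zero h hb), one_mul]
    simp_rw [h2]
    rw [← Finset.mul_sum, hJ, mul_neg, ← map_mul]
    simp

theorem ind2 (hF : ringChar F ≠ 2) (a b t : F) (ha : a ≠ 0) (hb : b ≠ 0) :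
    (∑ x : F, ∑ y : F, if a * x ^ 2 + b * y ^ 2 = t then (1 : ℤ) else 0) =
      if t = 0 then Fintype.card F + ((Fintype.card F : ℤ) - 1) * quadraticChar F (-(a * b))
      else Fintype.card F - quadraticChar F (-(a * b)) := by
  rw [Finset.sum_comm]
  have h1 : ∀ y : F, (∑ x : F, if a * x ^ 2 + b * y ^ 2 = t then (1 : ℤ) else 0) =
      1 + quadraticChar F (a * t + (-(a * b)) * y ^ 2) := by
    intro y
    have := ind1 hF a (t - b * y ^ 2) ha
    simp_rw [eq_sub_iff_add_eq] at this
    rw [this]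
    congr 2; ring
  simp_rw [h1]
  rw [Finset.sum_add_distrib, sum_sq hF (fun s => quadraticChar F (a * t + (-(a * b)) * s))]
  have hab : -(a * b) ≠ 0 := neg_ne_zero.2 (mul_ne_zero ha hb)
  simp_rw [add_mul, one_mul]
  rw [Finset.sum_add_distrib, sum_chi_lin hF _ _ hab, sum_chi_chi hF _ _ hab]
  simp only [mul_eq_zero, ha, false_or]
  split_ifs <;> simp [Finset.card_univ]; ring

theorem ind3 (hF : ringChar F ≠ 2) (a b c t : F) (ha : a ≠ 0) (hb : b ≠ 0) (hc : c ≠ 0) :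
    (∑ z : F, ∑ x : F, ∑ y : F, if a * x ^ 2 + b * y ^ 2 + c * z ^ 2 = t then (1 : ℤ) else 0) =
      (Fintype.card F : ℤ) ^ 2 + Fintype.card F * quadraticChar F (-(t * (a * b * c))) := by
  have h1 : ∀ z : F, (∑ x : F, ∑ y : F, if a * x ^ 2 + b * y ^ 2 + c * z ^ 2 = t
      then (1 : ℤ) else 0) = (Fintype.card F - quadraticChar F (-(a * b))) +
      (Fintype.card F * quadraticChar F (-(a * b))) * (if c * z ^ 2 = t then 1 else 0) := by
    intro z
    have := ind2 hF a b (t - c * z ^ 2) ha hb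
    simp_rw [eq_sub_iff_add_eq] at this
    rw [this]
    simp only [sub_eq_zero, eq_comm (a := t)]
    split_ifs <;> ring
  simp_rw [h1]
  rw [Finset.sum_add_distrib, ← Finset.mul_sum, ind1 hF c t hc]
  have : -(t * (a * b * c)) = (-(a * b)) * (c * t) := by ring
  rw [this, map_mul _ (-(a * b)) (c * t)]
  simp only [Finset.sum_const, Finset.card_univ, nsmul_eq_mul]
  ring

theorem cnt2 (hF : ringChar F ≠ 2) (M : Matrix (Fin 2) (Fin 2) F) (hM : M.IsSymm)
    (hd : M.det ≠ 0) (t : F) :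
    (Nat.card {x // quadVal M x = t} : ℤ) =
      if t = 0 then Fintype.card F + ((Fintype.card F : ℤ) - 1) * quadraticChar F (-M.det)
      else Fintype.card F - quadraticChar F (-M.det) := by
  obtain ⟨U, w, hU, hw⟩ := exists_diag (Ring.two_ne_zero hF) M hM
  have hdet := congrArg Matrix.det hw
  rw [Matrix.det_mul, Matrix.det_mul, Matrix.det_transpose, Matrix.det_diagonal,
    Fin.prod_univ_two] at hdet
  have hw0 : w 0 * w 1 ≠ 0 := by
    rw [← hdet]; exact mul_ne_zero (mul_ne_zero hU.ne_zero hd) hU.ne_zero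
  rw [← card_congr_quadVal M U hU t, hw, card_eq_sum_ind]
  have hq : quadraticChar F (-M.det) = quadraticChar F (-(w 0 * w 1)) := by
    rw [← hdet]
    have : -(U.det * M.det * U.det) = U.det ^ 2 * (-M.det) := by ring
    rw [this, map_mul, quadraticChar_sq_one' hU.ne_zero, one_mul]
  rw [hq, ← ind2 hF _ _ t (left_ne_zero_of_mul hw0) (right_ne_zero_of_mul hw0)]
  rw [← Equiv.sum_comp (finTwoArrowEquiv F).symm, Fintype.sum_prod_type]
  refine Finset.sum_congr rfl fun x _ => Finset.sum_congr rfl fun y _ => ?_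
  congr 1
  simp [quadVal, Fin.sum_univ_two, finTwoArrowEquiv]
  ring_nf

def fin3Equiv (F : Type*) : F × F × F ≃ (Fin 3 → F) where
  toFun x := ![x.2.1, x.2.2, x.1]
  invFun X := (X 2, X 0, X 1)
  left_inv x := rfl
  right_inv X := by ext i; fin_cases i <;> rfl

theorem cnt3 (hF : ringChar F ≠ 2) (M : Matrix (Fin 3) (Fin 3) F) (hM : M.IsSymm)
    (hd : M.det ≠ 0) (t : F) :
    (Nat.card {x // quadVal M x = t} : ℤ) =
      (Fintype.card F : ℤ) ^ 2 + Fintype.card F * quadraticChar F (-(t * M.det)) := by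
  obtain ⟨U, w, hU, hw⟩ := exists_diag (Ring.two_ne_zero hF) M hM
  have hdet := congrArg Matrix.det hw
  rw [Matrix.det_mul, Matrix.det_mul, Matrix.det_transpose, Matrix.det_diagonal,
    Fin.prod_univ_three] at hdet
  have hw0 : w 0 * w 1 * w 2 ≠ 0 := by
    rw [← hdet]; exact mul_ne_zero (mul_ne_zero hU.ne_zero hd) hU.ne_zero
  rw [← card_congr_quadVal M U hU t, hw, card_eq_sum_ind]
  have hq : quadraticChar F (-(t * M.det)) = quadraticChar F (-(t * (w 0 * w 1 * w 2))) := by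
    rw [← hdet]
    have : -(t * (U.det * M.det * U.det)) = U.det ^ 2 * (-(t * M.det)) := by ring
    rw [this, map_mul, quadraticChar_sq_one' hU.ne_zero, one_mul]
  rw [hq, ← ind3 hF _ _ _ t (left_ne_zero_of_mul (left_ne_zero_of_mul hw0))
    (right_ne_zero_of_mul (left_ne_zero_of_mul hw0)) (right_ne_zero_of_mul hw0)]
  rw [← Equiv.sum_comp (fin3Equiv F), Fintype.sum_prod_type]
  refine Finset.sum_congr rfl fun z _ => ?_
  rw [Fintype.sum_prod_type]
  refine Finset.sum_congr rfl fun x _ => Finset.sum_congr rfl fun y _ => ?_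
  congr 1
  have h0 : fin3Equiv F (z, x, y) 0 = x := rfl
  have h1 : fin3Equiv F (z, x, y) 1 = y := rfl
  have h2 : fin3Equiv F (z, x, y) 2 = z := rfl
  simp [quadVal, Fin.sum_univ_three, h0, h1, h2]
  ring_nf

end FF

/-! ### Unimodular case -/

theorem zmod_ringChar (p : ℕ) [Fact p.Prime] (hp2 : p ≠ 2) : ringChar (ZMod p) ≠ 2 := by
  rwa [ZMod.ringChar_zmod_n]

theorem hNS0 (p : ℕ) [Fact p.Prime] (A : TernMat) (hd : ¬ (p : ℤ) ∣ A.det) (x : Fin 3 → ZMod p) :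
    (∀ i, AXv p A x i = 0) ↔ ∀ i, (fun _ : Fin 3 => p) i = p → x i = 0 := by
  constructor
  · intro h i _
    have h1 : (A.map (Int.castRingHom (ZMod p))).det ≠ 0 := by
      rw [← RingHom.mapMatrix_apply, ← RingHom.map_det]
      simp only [eq_intCast, ne_eq]
      rwa [ZMod.intCast_zmod_eq_zero_iff_dvd]
    have h2 : (A.map (Int.castRingHom (ZMod p))) *ᵥ x = 0 := funext h
    exact congrFun (Matrix.eq_zero_of_mulVec_eq_zero h1 h2) i
  · intro h i
    unfold AXv
    exact Finset.sum_eq_zero fun j _ => by rw [h j rfl, mul_zero]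

theorem NN_level1 (p : ℕ) [Fact p.Prime] (hp2 : p ≠ 2) (A : TernMat) (hA : A.IsSymm)
    (hd : ¬ (p : ℤ) ∣ A.det) (n : ℤ) :
    (NN p A n : ℤ) = (p : ℤ) ^ 2 + p * legendreSym p (-(n * A.det)) := by
  have h1 : (A.map (Int.castRingHom (ZMod p))).det = (A.det : ZMod p) := by
    rw [← RingHom.mapMatrix_apply, ← RingHom.map_det]
    simp only [eq_intCast]
  have := cnt3 (zmod_ringChar p hp2) (A.map (Int.castRingHom (ZMod p)))
    (by ext i j; simp only [transpose_apply, map_apply, hA.apply])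
    (by rw [h1, Ne, ZMod.intCast_zmod_eq_zero_iff_dvd]; exact hd) n
  rw [h1, ZMod.card] at this
  rw [legendreSym, Int.cast_neg, Int.cast_mul]
  convert this
  rfl

theorem GG_level1_zero (p : ℕ) [Fact p.Prime] (hp2 : p ≠ 2) (A : TernMat) (hA : A.IsSymm)
    (hd : ¬ (p : ℤ) ∣ A.det) (n : ℤ) (hn : (p : ℤ) ∣ n) :
    (GG p A n : ℤ) = (p : ℤ) ^ 2 - 1 := by
  have hp : p.Prime := Fact.out
  have h1 := NN_level1 p hp2 A hA hd n
  have h2 : legendreSym p (-(n * A.det)) = 0 := by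
    rw [legendreSym.eq_zero_iff, ZMod.intCast_zmod_eq_zero_iff_dvd]
    exact (dvd_neg.2 (hn.mul_right _))
  have h3 : SS p A n = 1 := by
    unfold SS
    rw [Nat.card_eq_one_iff_unique]
    have key : ∀ X : Fin 3 → ZMod p, (¬ ∃ i, IsUnit (AXv p A X i)) → X = 0 := by
      intro X hX
      push Not at hX
      funext i
      exact (hNS0 p A hd X).1 (fun i => by simpa [isUnit_iff_ne_zero] using hX i) i rfl
    refine ⟨⟨fun X Y => Subtype.ext ?_⟩, ⟨0, ?_, ?_⟩⟩
    · rw [key X.1 X.2.2, key Y.1 Y.2.2]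
    · rw [(ZMod.intCast_zmod_eq_zero_iff_dvd n p).2 hn]
      simp [QF]
    · simp [AXv]
  have h4 := NN_eq p A n
  rw [h2] at h1
  rw [h4, h3] at h1
  push_cast at h1
  linarith

theorem NN0_unit (p : ℕ) [Fact p.Prime] (hp2 : p ≠ 2) (A : TernMat) (hA : A.IsSymm)
    (hd : ¬ (p : ℤ) ∣ A.det) (n : ℤ) (hn : ¬ (p : ℤ) ∣ n) (j : ℕ) :
    (NN (p ^ (j + 1)) A n : ℝ) =
      (p : ℝ) ^ (2 * (j + 1)) * (1 + legendreSym p (-(n * A.det)) / p) := by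
  have hp : p.Prime := Fact.out
  have hp0 : (p : ℝ) ≠ 0 := by exact_mod_cast hp.ne_zero
  have : NeZero (p ^ (j + 1)) := ⟨pow_ne_zero _ hp.ne_zero⟩
  have h1 := NN_level1 p hp2 A hA hd n
  have hs : ∀ j, SS (p ^ (j + 1)) A n = 0 := fun j => SS_zero p hp (j + 1) 2 1 (by omega) A A
    (fun _ => p) (fun _ => Or.inr rfl) (hNS0 p A hd) (fun i j => by ring) n (by omega) (by omega)
    (by rwa [pow_one])
  have h2 := NN_eq p A n
  have h3 := hs 0
  rw [zero_add, pow_one] at h3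
  rw [NN_eq, hs, GG_eq p hp hp2 j A hA, add_zero]
  rw [h3, add_zero] at h2
  rw [← h2]
  push_cast
  have h1' : (NN p A n : ℝ) = (p : ℝ) ^ 2 + p * legendreSym p (-(n * A.det)) := by exact_mod_cast h1
  rw [h1']
  field_simp
  ring

theorem NN0_one (p : ℕ) [Fact p.Prime] (hp2 : p ≠ 2) (A : TernMat) (hA : A.IsSymm)
    (hd : ¬ (p : ℤ) ∣ A.det) (n : ℤ) (hn : ¬ (p : ℤ) ∣ n) (j : ℕ) :
    (NN (p ^ (j + 2)) A (p * n) : ℝ) =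
      (p : ℝ) ^ (2 * (j + 2)) * (1 - 1 / p ^ 2) := by
  have hp : p.Prime := Fact.out
  have hp0 : (p : ℝ) ≠ 0 := by exact_mod_cast hp.ne_zero
  have : NeZero (p ^ (j + 2)) := ⟨pow_ne_zero _ hp.ne_zero⟩
  have h1 := GG_level1_zero p hp2 A hA hd (p * n) (dvd_mul_right _ _)
  have hs : SS (p ^ (j + 2)) A (p * n) = 0 := SS_zero p hp (j + 2) 2 2 (by omega) A A
    (fun _ => p) (fun _ => Or.inr rfl) (hNS0 p A hd) (fun i j => by ring) _ (by omega) (by omega)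
    (by rw [pow_two, mul_dvd_mul_iff_left (by exact_mod_cast hp.ne_zero)]; exact hn)
  rw [NN_eq, hs, GG_eq p hp hp2 (j + 1) A hA, add_zero]
  push_cast
  have h1' : (GG p A (p * n) : ℝ) = (p : ℝ) ^ 2 - 1 := by exact_mod_cast h1
  rw [h1']
  field_simp
  ring

theorem NN0_step (p : ℕ) [Fact p.Prime] (hp2 : p ≠ 2) (A : TernMat) (hA : A.IsSymm)
    (hd : ¬ (p : ℤ) ∣ A.det) (n : ℤ) (s : ℕ) :
    (NN (p ^ (s + 2)) A (p ^ 2 * n) : ℝ) =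
      (p : ℝ) ^ (2 * (s + 2)) * (1 - 1 / p ^ 2) + p ^ 3 * NN (p ^ s) A n := by
  have hp : p.Prime := Fact.out
  have hp0 : (p : ℝ) ≠ 0 := by exact_mod_cast hp.ne_zero
  have : NeZero (p ^ (s + 2)) := ⟨pow_ne_zero _ hp.ne_zero⟩
  have h1 := GG_level1_zero p hp2 A hA hd (p ^ 2 * n)
    ((dvd_pow_self _ (by norm_num)).mul_right _)
  have hs := SS_eq p hp s 2 (s + 1) (by omega) A A
    (fun _ => p) (fun _ => Or.inr rfl) (hNS0 p A hd) (fun i j => by ring) n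
  have hs' : (SS (p ^ (s + 2)) A (p ^ 2 * n) : ℝ) = p ^ 3 * NN (p ^ s) A n := by
    have : (SS (p ^ (s + 2)) A (p ^ 2 * n) : ℝ) * p ^ 3 = p ^ (3 * 2) * NN (p ^ s) A n := by
      have := congrArg (Nat.cast : ℕ → ℝ) hs
      simpa using this
    apply mul_right_cancel₀ (pow_ne_zero 3 hp0)
    rw [this]; ring
  rw [NN_eq, GG_eq p hp hp2 (s + 1) A hA]
  push_cast
  have h1' : (GG p A (p ^ 2 * n) : ℝ) = (p : ℝ) ^ 2 - 1 := by exact_mod_cast h1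
  rw [h1', hs']
  field_simp
  ring

theorem NN0_even (p : ℕ) [Fact p.Prime] (hp2 : p ≠ 2) (A : TernMat) (hA : A.IsSymm)
    (hd : ¬ (p : ℤ) ∣ A.det) (m : ℤ) (hm : ¬ (p : ℤ) ∣ m) (k j : ℕ) :
    (NN (p ^ (2 * k + 1 + j)) A (p ^ (2 * k) * m) : ℝ) =
      (p : ℝ) ^ (2 * (2 * k + 1 + j)) * (1 + 1 / p - 1 / p ^ (k + 1) +
        legendreSym p (-(m * A.det)) * (1 / p ^ (k + 1))) := by
  have hp : p.Prime := Fact.out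
  have hp0 : (p : ℝ) ≠ 0 := by exact_mod_cast hp.ne_zero
  induction k with
  | zero =>
    have := NN0_unit p hp2 A hA hd m hm j
    rw [show 2 * 0 + 1 + j = j + 1 by ring, show (p : ℤ) ^ (2 * 0) * m = m by simp, this]
    field_simp
    ring
  | succ k ih =>
    have := NN0_step p hp2 A hA hd (p ^ (2 * k) * m) (2 * k + 1 + j)
    rw [show 2 * (k + 1) + 1 + j = 2 * k + 1 + j + 2 by ring,
      show (p : ℤ) ^ (2 * (k + 1)) * m = p ^ 2 * (p ^ (2 * k) * m) by ring, this, ih]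
    field_simp
    ring

theorem NN0_odd (p : ℕ) [Fact p.Prime] (hp2 : p ≠ 2) (A : TernMat) (hA : A.IsSymm)
    (hd : ¬ (p : ℤ) ∣ A.det) (m : ℤ) (hm : ¬ (p : ℤ) ∣ m) (k j : ℕ) :
    (NN (p ^ (2 * k + 2 + j)) A (p ^ (2 * k + 1) * m) : ℝ) =
      (p : ℝ) ^ (2 * (2 * k + 2 + j)) * (1 + 1 / p - 1 / p ^ (k + 1) - 1 / p ^ (k + 2)) := by
  have hp : p.Prime := Fact.out
  have hp0 : (p : ℝ) ≠ 0 := by exact_mod_cast hp.ne_zero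
  induction k with
  | zero =>
    have := NN0_one p hp2 A hA hd m hm j
    rw [show 2 * 0 + 2 + j = j + 2 by ring, show (p : ℤ) ^ (2 * 0 + 1) * m = p * m by simp, this]
    field_simp
    ring
  | succ k ih =>
    have := NN0_step p hp2 A hA hd (p ^ (2 * k + 1) * m) (2 * k + 2 + j)
    rw [show 2 * (k + 1) + 2 + j = 2 * k + 2 + j + 2 by ring,
      show (p : ℤ) ^ (2 * (k + 1) + 1) * m = p ^ 2 * (p ^ (2 * k + 1) * m) by ring, this, ih]
    field_simp
    ring

/-! ### The case of determinant of order one -/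

def BB (p : ℕ) (a b c u : ℤ) : TernMat := !![a, b, 0; b, c, 0; 0, 0, p * u]

def BB' (p : ℕ) (a b c u : ℤ) : TernMat := !![p * a, p * b, 0; p * b, p * c, 0; 0, 0, u]

theorem BB_symm (p : ℕ) (a b c u : ℤ) : (BB p a b c u).IsSymm := by
  ext i j; fin_cases i <;> fin_cases j <;> rfl

theorem BB'_symm (p : ℕ) (a b c u : ℤ) : (BB' p a b c u).IsSymm := by
  ext i j; fin_cases i <;> fin_cases j <;> rfl

theorem BB_scale (p : ℕ) (a b c u : ℤ) (i j : Fin 3) :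
    ((![p, p, 1] i : ℕ) : ℤ) * BB p a b c u i j * ((![p, p, 1] j : ℕ) : ℤ) =
      (p : ℤ) ^ 1 * BB' p a b c u i j := by
  fin_cases i <;> fin_cases j <;> simp [BB, BB'] <;> ring

theorem BB'_scale (p : ℕ) (a b c u : ℤ) (i j : Fin 3) :
    ((![1, 1, p] i : ℕ) : ℤ) * BB' p a b c u i j * ((![1, 1, p] j : ℕ) : ℤ) =
      (p : ℤ) ^ 1 * BB p a b c u i j := by
  fin_cases i <;> fin_cases j <;> simp [BB, BB'] <;> ring

theorem BB_NS (p : ℕ) [Fact p.Prime] (a b c u : ℤ) (hd : ¬ (p : ℤ) ∣ a * c - b ^ 2)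
    (x : Fin 3 → ZMod p) :
    (∀ i, AXv p (BB p a b c u) x i = 0) ↔ ∀ i, ![p, p, 1] i = p → x i = 0 := by
  have h1 : ((1 : ℕ) = p) ↔ False := by
    simpa using (Fact.out : p.Prime).one_lt.ne
  have hd' : (a : ZMod p) * c - b ^ 2 ≠ 0 := by
    have := (ZMod.intCast_zmod_eq_zero_iff_dvd (a * c - b ^ 2) p).not.2 hd
    push_cast at this; exact this
  simp only [Fin.forall_fin_succ, AXv, Fin.sum_univ_three, BB]
  simp [h1]
  constructor
  · rintro ⟨h2, h3⟩
    constructor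
    · apply (mul_eq_zero.1 _).resolve_left hd'
      linear_combination (c : ZMod p) * h2 - b * h3
    · apply (mul_eq_zero.1 _).resolve_left hd'
      linear_combination (a : ZMod p) * h3 - b * h2
  · rintro ⟨h2, h3⟩
    simp [h2, h3]

theorem BB'_NS (p : ℕ) [Fact p.Prime] (a b c u : ℤ) (hu : ¬ (p : ℤ) ∣ u)
    (x : Fin 3 → ZMod p) :
    (∀ i, AXv p (BB' p a b c u) x i = 0) ↔ ∀ i, ![1, 1, p] i = p → x i = 0 := by
  have h1 : ((1 : ℕ) = p) ↔ False := by
    simpa using (Fact.out : p.Prime).one_lt.ne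
  have hu' : (u : ZMod p) ≠ 0 := (ZMod.intCast_zmod_eq_zero_iff_dvd u p).not.2 hu
  simp only [Fin.forall_fin_succ, AXv, Fin.sum_univ_three, BB']
  simp [h1, hu']

theorem NN_zero (A : TernMat) (n : ℤ) (p : ℕ) : NN (p ^ 0) A n = 1 := by
  unfold NN
  rw [pow_zero, Nat.card_eq_one_iff_unique]
  exact ⟨⟨fun X Y => Subtype.ext (Subsingleton.elim _ _)⟩, ⟨0, Subsingleton.elim _ _⟩⟩

theorem BB_level1 (p : ℕ) [Fact p.Prime] (hp2 : p ≠ 2) (a b c u : ℤ)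
    (hd : ¬ (p : ℤ) ∣ a * c - b ^ 2) (n : ℤ) :
    (NN p (BB p a b c u) n : ℤ) = p * (if (p : ℤ) ∣ n then
      p + ((p : ℤ) - 1) * legendreSym p (-(a * c - b ^ 2))
      else p - legendreSym p (-(a * c - b ^ 2))) := by
  let M : Matrix (Fin 2) (Fin 2) (ZMod p) := !![(a : ZMod p), b; b, c]
  have hM : M.det = ((a * c - b ^ 2 : ℤ) : ZMod p) := by
    simp [M, Matrix.det_fin_two]; ring
  have h := cnt2 (zmod_ringChar p hp2) M
    (by ext i j; fin_cases i <;> fin_cases j <;> rfl)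
    (by rw [hM, Ne, ZMod.intCast_zmod_eq_zero_iff_dvd]; exact hd) (n : ZMod p)
  have e : NN p (BB p a b c u) n = p * Nat.card {x // quadVal M x = (n : ZMod p)} := by
    rw [show p * Nat.card {x // quadVal M x = (n : ZMod p)} =
      Nat.card (ZMod p) * Nat.card {x // quadVal M x = (n : ZMod p)} by rw [Nat.card_zmod],
      ← Nat.card_prod]
    have key : ∀ X : Fin 3 → ZMod p, QF p (BB p a b c u) X = quadVal M ![X 0, X 1] := by
      intro X
      simp [QF, quadVal, BB, M, Fin.sum_univ_three]
    exact Nat.card_congr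
      { toFun := fun X => (X.1 2, ⟨![X.1 0, X.1 1], by rw [← key]; exact X.2⟩)
        invFun := fun y => ⟨![y.2.1 0, y.2.1 1, y.1], by
          rw [key]
          have : ![y.2.1 0, y.2.1 1] = y.2.1 := by ext i; fin_cases i <;> rfl
          simpa [this] using y.2.2⟩
        left_inv := fun X => by ext i; fin_cases i <;> rfl
        right_inv := fun y => by
          refine Prod.ext rfl (Subtype.ext ?_)
          ext i; fin_cases i <;> rfl }
  rw [e, Nat.cast_mul, h, hM, ZMod.card, legendreSym, Int.cast_neg]
  simp only [ZMod.intCast_zmod_eq_zero_iff_dvd]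
  congr
  all_goals exact Subsingleton.elim _ _

theorem BB'_level1 (p : ℕ) [Fact p.Prime] (hp2 : p ≠ 2) (a b c u : ℤ)
    (hu : ¬ (p : ℤ) ∣ u) (n : ℤ) :
    (NN p (BB' p a b c u) n : ℤ) = p ^ 2 * (1 + legendreSym p (u * n)) := by
  have h := ind1 (zmod_ringChar p hp2) (u : ZMod p) n
    ((ZMod.intCast_zmod_eq_zero_iff_dvd u p).not.2 hu)
  rw [← card_eq_sum_ind] at h
  have e : NN p (BB' p a b c u) n = p * p * Nat.card {x : ZMod p // (u : ZMod p) * x ^ 2 = n} := by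
    rw [show p * p * Nat.card {x : ZMod p // (u : ZMod p) * x ^ 2 = n} =
      Nat.card (ZMod p) * Nat.card (ZMod p) * Nat.card {x : ZMod p // (u : ZMod p) * x ^ 2 = n}
      by rw [Nat.card_zmod], ← Nat.card_prod, ← Nat.card_prod]
    have key : ∀ X : Fin 3 → ZMod p, QF p (BB' p a b c u) X = u * (X 2) ^ 2 := by
      intro X
      simp [QF, BB', Fin.sum_univ_three]
      ring
    exact Nat.card_congr
      { toFun := fun X => ((X.1 0, X.1 1), ⟨X.1 2, by rw [← key]; exact X.2⟩)
        invFun := fun y => ⟨![y.1.1, y.1.2, y.2.1], by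
          rw [key]
          exact y.2.2⟩
        left_inv := fun X => by ext i; fin_cases i <;> rfl
        right_inv := fun y => rfl }
  rw [e, Nat.cast_mul, h, legendreSym, Int.cast_mul]
  push_cast
  rw [pow_two]
  congr
  all_goals exact Subsingleton.elim _ _

theorem vec_or1 (p : ℕ) : ∀ i, (![p, p, 1] : Fin 3 → ℕ) i = 1 ∨ (![p, p, 1] : Fin 3 → ℕ) i = p := by
  intro i; fin_cases i <;> simp

theorem vec_or2 (p : ℕ) : ∀ i, (![1, 1, p] : Fin 3 → ℕ) i = 1 ∨ (![1, 1, p] : Fin 3 → ℕ) i = p := by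
  intro i; fin_cases i <;> simp

section
variable (p : ℕ) [Fact p.Prime] (hp2 : p ≠ 2) (a b c u : ℤ)
    (hd : ¬ (p : ℤ) ∣ a * c - b ^ 2) (hu : ¬ (p : ℤ) ∣ u)

theorem SS_BB (hd : ¬ (p : ℤ) ∣ a * c - b ^ 2) (n : ℤ) (s : ℕ) :
    (SS (p ^ (s + 1)) (BB p a b c u) (p * n) : ℝ) = p * NN (p ^ s) (BB' p a b c u) n := by
  have hp : p.Prime := Fact.out
  have hp0 : (p : ℝ) ≠ 0 := by exact_mod_cast hp.ne_zero
  have hs := SS_eq p hp s 1 s rfl (BB p a b c u) (BB' p a b c u) ![p, p, 1] (vec_or1 p)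
    (BB_NS p a b c u hd) (BB_scale p a b c u) n
  rw [pow_one (p : ℤ)] at hs
  have := congrArg (Nat.cast : ℕ → ℝ) hs
  simp [Fin.prod_univ_three] at this
  apply mul_right_cancel₀ (mul_ne_zero hp0 hp0)
  rw [this]; ring

theorem SS_BB' (hu : ¬ (p : ℤ) ∣ u) (n : ℤ) (s : ℕ) :
    (SS (p ^ (s + 1)) (BB' p a b c u) (p * n) : ℝ) = p ^ 2 * NN (p ^ s) (BB p a b c u) n := by
  have hp : p.Prime := Fact.out
  have hp0 : (p : ℝ) ≠ 0 := by exact_mod_cast hp.ne_zero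
  have hs := SS_eq p hp s 1 s rfl (BB' p a b c u) (BB p a b c u) ![1, 1, p] (vec_or2 p)
    (BB'_NS p a b c u hu) (BB'_scale p a b c u) n
  rw [pow_one (p : ℤ)] at hs
  have := congrArg (Nat.cast : ℕ → ℝ) hs
  simp [Fin.prod_univ_three] at this
  apply mul_right_cancel₀ hp0
  rw [this]; ring

theorem BB_unit (hp2 : p ≠ 2) (hd : ¬ (p : ℤ) ∣ a * c - b ^ 2) (n : ℤ) (hn : ¬ (p : ℤ) ∣ n) (j : ℕ) :
    (NN (p ^ (j + 1)) (BB p a b c u) n : ℝ) =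
      (p : ℝ) ^ (2 * (j + 1)) * (1 - legendreSym p (-(a * c - b ^ 2)) / p) := by
  have hp : p.Prime := Fact.out
  have hp0 : (p : ℝ) ≠ 0 := by exact_mod_cast hp.ne_zero
  have : NeZero (p ^ (j + 1)) := ⟨pow_ne_zero _ hp.ne_zero⟩
  have h1 := BB_level1 p hp2 a b c u hd n
  rw [if_neg hn] at h1
  have hs : ∀ j, SS (p ^ (j + 1)) (BB p a b c u) n = 0 := fun j =>
    SS_zero p hp (j + 1) 1 1 (by omega) (BB p a b c u) (BB' p a b c u) ![p, p, 1] (vec_or1 p)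
    (BB_NS p a b c u hd) (BB_scale p a b c u) n (by omega) (by omega)
    (by rwa [pow_one])
  have h2 := NN_eq p (BB p a b c u) n
  have h3 := hs 0
  rw [zero_add, pow_one] at h3
  rw [NN_eq, hs, GG_eq p hp hp2 j _ (BB_symm p a b c u), add_zero]
  rw [h3, add_zero] at h2
  rw [← h2]
  push_cast
  have h1' : (NN p (BB p a b c u) n : ℝ) = (p : ℝ) * (p - legendreSym p (-(a * c - b ^ 2))) := by
    exact_mod_cast h1
  rw [h1']
  field_simp
  ring

theorem BB'_unit (hp2 : p ≠ 2) (hu : ¬ (p : ℤ) ∣ u) (n : ℤ) (hn : ¬ (p : ℤ) ∣ n) (j : ℕ) :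
    (NN (p ^ (j + 1)) (BB' p a b c u) n : ℝ) =
      (p : ℝ) ^ (2 * (j + 1)) * (1 + legendreSym p (u * n)) := by
  have hp : p.Prime := Fact.out
  have hp0 : (p : ℝ) ≠ 0 := by exact_mod_cast hp.ne_zero
  have : NeZero (p ^ (j + 1)) := ⟨pow_ne_zero _ hp.ne_zero⟩
  have h1 := BB'_level1 p hp2 a b c u hu n
  have hs : ∀ j, SS (p ^ (j + 1)) (BB' p a b c u) n = 0 := fun j =>
    SS_zero p hp (j + 1) 1 1 (by omega) (BB' p a b c u) (BB p a b c u) ![1, 1, p] (vec_or2 p)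
    (BB'_NS p a b c u hu) (BB'_scale p a b c u) n (by omega) (by omega)
    (by rwa [pow_one])
  have h2 := NN_eq p (BB' p a b c u) n
  have h3 := hs 0
  rw [zero_add, pow_one] at h3
  rw [NN_eq, hs, GG_eq p hp hp2 j _ (BB'_symm p a b c u), add_zero]
  rw [h3, add_zero] at h2
  rw [← h2]
  push_cast
  have h1' : (NN p (BB' p a b c u) n : ℝ) = (p : ℝ) ^ 2 * (1 + legendreSym p (u * n)) := by
    exact_mod_cast h1
  rw [h1']
  ring

theorem GG_BB (hp2 : p ≠ 2) (hd : ¬ (p : ℤ) ∣ a * c - b ^ 2) (n : ℤ) :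
    (GG p (BB p a b c u) (p * n) : ℝ) =
      p * (p - 1) * (1 + legendreSym p (-(a * c - b ^ 2))) := by
  have h1 := BB_level1 p hp2 a b c u hd (p * n)
  rw [if_pos (dvd_mul_right _ _)] at h1
  have h2 := SS_BB p a b c u hd n 0
  rw [NN_zero, zero_add, pow_one] at h2
  have h3 := NN_eq p (BB p a b c u) (p * n)
  rw [h3] at h1
  have h4 := congrArg (Int.cast : ℤ → ℝ) h1
  push_cast at h4 h2
  rw [h2] at h4
  linear_combination h4

theorem GG_BB' (hp2 : p ≠ 2) (hu : ¬ (p : ℤ) ∣ u) (n : ℤ) :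
    (GG p (BB' p a b c u) (p * n) : ℝ) = 0 := by
  have h1 := BB'_level1 p hp2 a b c u hu (p * n)
  have h0 : legendreSym p (u * (p * n)) = 0 := by
    rw [legendreSym.eq_zero_iff, ZMod.intCast_zmod_eq_zero_iff_dvd]
    exact (dvd_mul_right _ _).mul_left _
  rw [h0] at h1
  have h2 := SS_BB' p a b c u hu n 0
  rw [NN_zero, zero_add, pow_one] at h2
  have h3 := NN_eq p (BB' p a b c u) (p * n)
  rw [h3] at h1
  have h4 := congrArg (Int.cast : ℤ → ℝ) h1
  push_cast at h4 h2
  rw [h2] at h4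
  linear_combination h4

theorem BB_step1 (hp2 : p ≠ 2) (hd : ¬ (p : ℤ) ∣ a * c - b ^ 2) (n : ℤ) (s : ℕ) :
    (NN (p ^ (s + 1)) (BB p a b c u) (p * n) : ℝ) =
      p ^ (2 * s) * (p * (p - 1) * (1 + legendreSym p (-(a * c - b ^ 2)))) +
        p * NN (p ^ s) (BB' p a b c u) n := by
  have hp : p.Prime := Fact.out
  have : NeZero (p ^ (s + 1)) := ⟨pow_ne_zero _ hp.ne_zero⟩
  rw [NN_eq, GG_eq p hp hp2 s _ (BB_symm p a b c u)]
  push_cast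
  rw [SS_BB p a b c u hd, GG_BB p a b c u hp2 hd]

theorem BB'_step1 (hp2 : p ≠ 2) (hu : ¬ (p : ℤ) ∣ u) (n : ℤ) (s : ℕ) :
    (NN (p ^ (s + 1)) (BB' p a b c u) (p * n) : ℝ) = p ^ 2 * NN (p ^ s) (BB p a b c u) n := by
  have hp : p.Prime := Fact.out
  have : NeZero (p ^ (s + 1)) := ⟨pow_ne_zero _ hp.ne_zero⟩
  rw [NN_eq, GG_eq p hp hp2 s _ (BB'_symm p a b c u)]
  push_cast
  rw [SS_BB' p a b c u hu, GG_BB' p a b c u hp2 hu]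
  ring

theorem BB_even (hp2 : p ≠ 2) (hd : ¬ (p : ℤ) ∣ a * c - b ^ 2) (hu : ¬ (p : ℤ) ∣ u)
    (m : ℤ) (hm : ¬ (p : ℤ) ∣ m) (k j : ℕ) :
    (NN (p ^ (2 * k + 1 + j)) (BB p a b c u) (p ^ (2 * k) * m) : ℝ) =
      (p : ℝ) ^ (2 * (2 * k + 1 + j)) * (1 + (1 - 1 / p ^ k - 1 / p ^ (k + 1)) *
        legendreSym p (-(a * c - b ^ 2))) := by
  have hp : p.Prime := Fact.out
  have hp0 : (p : ℝ) ≠ 0 := by exact_mod_cast hp.ne_zero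
  induction k with
  | zero =>
    have := BB_unit p a b c u hp2 hd m hm j
    rw [show 2 * 0 + 1 + j = j + 1 by ring, show (p : ℤ) ^ (2 * 0) * m = m by simp, this]
    field_simp
    ring
  | succ k ih =>
    have h1 := BB_step1 p a b c u hp2 hd (p * (p ^ (2 * k) * m)) (2 * k + 1 + j + 1)
    have h2 := BB'_step1 p a b c u hp2 hu (p ^ (2 * k) * m) (2 * k + 1 + j)
    rw [show 2 * (k + 1) + 1 + j = 2 * k + 1 + j + 1 + 1 by ring,
      show (p : ℤ) ^ (2 * (k + 1)) * m = p * (p * (p ^ (2 * k) * m)) by ring, h1, h2, ih]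
    field_simp
    ring

theorem BB_odd (hp2 : p ≠ 2) (hd : ¬ (p : ℤ) ∣ a * c - b ^ 2) (hu : ¬ (p : ℤ) ∣ u)
    (m : ℤ) (hm : ¬ (p : ℤ) ∣ m) (k j : ℕ) :
    (NN (p ^ (2 * k + 2 + j)) (BB p a b c u) (p ^ (2 * k + 1) * m) : ℝ) =
      (p : ℝ) ^ (2 * (2 * k + 2 + j)) * (1 + (1 - 1 / p ^ (k + 1)) *
        legendreSym p (-(a * c - b ^ 2)) + legendreSym p (u * m) * (1 / p ^ (k + 1))) := by
  have hp : p.Prime := Fact.out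
  have hp0 : (p : ℝ) ≠ 0 := by exact_mod_cast hp.ne_zero
  induction k with
  | zero =>
    have h1 := BB_step1 p a b c u hp2 hd m (j + 1)
    have h2 := BB'_unit p a b c u hp2 hu m hm j
    rw [show 2 * 0 + 2 + j = j + 1 + 1 by ring, show (p : ℤ) ^ (2 * 0 + 1) * m = p * m by simp,
      h1, h2]
    field_simp
    ring
  | succ k ih =>
    have h1 := BB_step1 p a b c u hp2 hd (p * (p ^ (2 * k + 1) * m)) (2 * k + 2 + j + 1)
    have h2 := BB'_step1 p a b c u hp2 hu (p ^ (2 * k + 1) * m) (2 * k + 2 + j)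
    rw [show 2 * (k + 1) + 2 + j = 2 * k + 2 + j + 1 + 1 by ring,
      show (p : ℤ) ^ (2 * (k + 1) + 1) * m = p * (p * (p ^ (2 * k + 1) * m)) by ring, h1, h2, ih]
    field_simp
    ring

end

/-! ### Approximation and conclusion -/

theorem blockMat3_eq {p : ℕ} [Fact p.Prime] (M : Matrix (Fin 2) (Fin 2) ℤ_[p]) (u : ℤ_[p]) :
    blockMat3 2 (by norm_num) M (Matrix.diagonal ![u]) =
      !![M 0 0, M 0 1, 0; M 1 0, M 1 1, 0; 0, 0, u] := by
  ext i j
  fin_cases i <;> fin_cases j <;> rfl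

theorem appr_toZMod {p : ℕ} [Fact p.Prime] (x : ℤ_[p]) (r : ℕ) (hr : r ≠ 0) :
    (((x.appr r : ℕ) : ℤ) : ZMod p) = PadicInt.toZMod x := by
  have h := PadicInt.appr_spec r x
  rw [Ideal.mem_span_singleton] at h
  obtain ⟨y, hy⟩ := h
  have h2 : x = x.appr r + p ^ r * y := by rw [← hy]; ring
  conv_rhs => rw [h2]
  simp [hr]

theorem appr_toZModPow {p : ℕ} [Fact p.Prime] (x : ℤ_[p]) (r : ℕ) :
    (((x.appr r : ℕ) : ℤ) : ZMod (p ^ r)) = PadicInt.toZModPow r x := by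
  have h := PadicInt.appr_spec r x
  rw [Ideal.mem_span_singleton] at h
  obtain ⟨y, hy⟩ := h
  have h2 : x = x.appr r + p ^ r * y := by rw [← hy]; ring
  conv_rhs => rw [h2]
  have h3 : ((p : ZMod (p ^ r))) ^ r = 0 := by
    rw [← Nat.cast_pow, ZMod.natCast_self]
  simp [h3]

theorem padic_reduce (p : ℕ) [Fact p.Prime] (A : TernMat) (hA : A.IsSymm) (d' : ℤ)
    (hdet : A.det = p * d') (hd' : ¬ (p : ℤ) ∣ d') (M : Matrix (Fin 2) (Fin 2) ℤ_[p]) (u : ℤ_[p])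
    (hM : IsUnit M.det) (hu : (p : ℤ_[p]) ∣ u)
    (hiso : PadicIsomP p (padicMat p A) (blockMat3 2 (by norm_num) M (Matrix.diagonal ![u])))
    (r : ℕ) (hr : r ≠ 0) :
    ∃ a b c u0 : ℤ, ¬ (p : ℤ) ∣ a * c - b ^ 2 ∧ ¬ (p : ℤ) ∣ u0 ∧
      ((a * c - b ^ 2 : ℤ) : ZMod p) = PadicInt.toZMod M.det ∧
      (∃ w : ZMod p, w ≠ 0 ∧ w ^ 2 * d' = ((a * c - b ^ 2 : ℤ) : ZMod p) * u0) ∧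
      ∀ n : ℤ, NN (p ^ r) A n = NN (p ^ r) (BB p a b c u0) n := by
  have hp : p.Prime := Fact.out
  obtain ⟨v, rfl⟩ := hu
  obtain ⟨U, hU, hUA⟩ := hiso
  rw [blockMat3_eq] at hUA
  have hAs : (padicMat p A)ᵀ = padicMat p A := by
    ext i j; simp only [padicMat, transpose_apply, map_apply, hA.apply]
  have hsym : M 1 0 = M 0 1 := by
    have h1 : (Uᵀ * padicMat p A * U)ᵀ = Uᵀ * padicMat p A * U := by
      rw [transpose_mul, transpose_mul, transpose_transpose, hAs, Matrix.mul_assoc]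
    rw [hUA] at h1
    have := congrFun (congrFun h1 0) 1
    simpa using this
  have hMd : M.det = M 0 0 * M 1 1 - M 0 1 ^ 2 := by
    rw [Matrix.det_fin_two, hsym]; ring
  have hAd : (padicMat p A).det = p * d' := by
    have : (padicMat p A).det = ((A.det : ℤ) : ℤ_[p]) := by
      have := (RingHom.map_det (Int.castRingHom ℤ_[p]) A)
      simpa [padicMat] using this.symm
    rw [this, hdet]; push_cast; rfl
  have hp0 : (p : ℤ_[p]) ≠ 0 := by exact_mod_cast hp.ne_zero
  have hdd : U.det ^ 2 * d' = M.det * v := by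
    have h1 := congrArg Matrix.det hUA
    rw [det_mul, det_mul, det_transpose, hAd, det_fin_three !![M 0 0, M 0 1, 0; M 1 0, M 1 1, 0; 0, 0, (p : ℤ_[p]) * v]] at h1
    simp [hsym] at h1
    apply mul_left_cancel₀ hp0
    rw [hMd]
    linear_combination h1
  have hac : (((M 0 0).appr r * (M 1 1).appr r - (M 0 1).appr r ^ 2 : ℤ) : ZMod p) =
      PadicInt.toZMod M.det := by
    rw [hMd, map_sub, map_mul, map_pow, ← appr_toZMod _ r hr, ← appr_toZMod _ r hr,
      ← appr_toZMod _ r hr]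
    push_cast; rfl
  have hd0 : PadicInt.toZMod M.det ≠ 0 := (hM.map PadicInt.toZMod).ne_zero
  have hw0 : PadicInt.toZMod U.det ≠ 0 := (hU.map PadicInt.toZMod).ne_zero
  have hd0' : (d' : ZMod p) ≠ 0 := (ZMod.intCast_zmod_eq_zero_iff_dvd d' p).not.2 hd'
  have hdd' := congrArg PadicInt.toZMod hdd
  rw [map_mul, map_mul, map_pow, map_intCast] at hdd'
  refine ⟨(M 0 0).appr r, (M 0 1).appr r, (M 1 1).appr r, v.appr r, ?_, ?_, hac,
    ⟨PadicInt.toZMod U.det, hw0, ?_⟩, ?_⟩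
  · rw [← ZMod.intCast_zmod_eq_zero_iff_dvd, hac]; exact hd0
  · rw [← ZMod.intCast_zmod_eq_zero_iff_dvd, appr_toZMod _ r hr]
    intro h0
    rw [h0, mul_zero] at hdd'
    exact mul_ne_zero (pow_ne_zero 2 hw0) hd0' hdd'
  · rw [hac, appr_toZMod _ r hr]; exact hdd'
  · intro n
    let φ : ℤ_[p] →+* ZMod (p ^ r) := PadicInt.toZModPow r
    have h1 := card_congr_quadVal (A.map (Int.cast : ℤ → ZMod (p ^ r))) (U.map φ)
      (by
        have := hU.map φ
        rwa [RingHom.map_det, RingHom.mapMatrix_apply] at this) (n : ZMod (p ^ r))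
    have h2 : (U.map φ)ᵀ * (A.map (Int.cast : ℤ → ZMod (p ^ r))) * (U.map φ) =
        (BB p ((M 0 0).appr r) ((M 0 1).appr r) ((M 1 1).appr r) (v.appr r)).map
          (Int.cast : ℤ → ZMod (p ^ r)) := by
      have h3 := congrArg (fun N : Matrix (Fin 3) (Fin 3) ℤ_[p] => N.map φ) hUA
      simp only [Matrix.map_mul, ← transpose_map] at h3
      have h4 : (padicMat p A).map φ = A.map (Int.cast : ℤ → ZMod (p ^ r)) := by
        ext i j; simp [padicMat]
      rw [h4] at h3
      rw [← transpose_map, h3]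
      have e : ∀ x : ℤ_[p], ((x.appr r : ℕ) : ZMod (p ^ r)) = PadicInt.toZModPow r x :=
        fun x => by rw [← appr_toZModPow x r, Int.cast_natCast]
      ext i j
      fin_cases i <;> fin_cases j <;> simp [BB, φ, e, hsym]
    rw [h2] at h1
    exact h1.symm

theorem det_ne_zero_of_isLat (A : TernMat) (hA : IsLat A) : A.det ≠ 0 := by
  intro h
  obtain ⟨v, hv, h0⟩ := Matrix.exists_mulVec_eq_zero_iff.2 h
  have := hA.2 v hv
  rw [quadVal_eq, h0, dotProduct_zero] at this
  exact lt_irrefl _ this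

theorem localDensity_of (p : ℕ) (hp : p.Prime) (n : ℤ) (A : TernMat) (α : ℝ) (R : ℕ)
    (h : ∀ j, (NN (p ^ (R + j)) A n : ℝ) = (p : ℝ) ^ (2 * (R + j)) * α) :
    localDensity p hp n A = α := by
  have hp0 : (p : ℝ) ≠ 0 := by exact_mod_cast hp.ne_zero
  refine Tendsto.limUnder_eq (Tendsto.congr' ?_ tendsto_const_nhds)
  filter_upwards [eventually_ge_atTop R] with r hr
  obtain ⟨j, rfl⟩ := Nat.exists_eq_add_of_le hr
  symm
  rw [div_eq_iff (pow_ne_zero _ hp0), mul_comm]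
  exact h j

theorem legendre_rel (p : ℕ) [Fact p.Prime] (m d' D u0 : ℤ) (w : ZMod p) (hw : w ≠ 0)
    (hD : ¬ (p : ℤ) ∣ D) (h : w ^ 2 * d' = (D : ZMod p) * u0) :
    legendreSym p (u0 * m) = legendreSym p (-(m * d')) * legendreSym p (-D) := by
  have hD' : (D : ZMod p) ≠ 0 := (ZMod.intCast_zmod_eq_zero_iff_dvd D p).not.2 hD
  rw [← legendreSym.mul]
  unfold legendreSym
  have h1 : quadraticChar (ZMod p) ((u0 * m : ℤ) : ZMod p) =
      quadraticChar (ZMod p) ((D : ZMod p) ^ 2 * ((u0 * m : ℤ) : ZMod p)) := by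
    rw [map_mul, quadraticChar_sq_one' hD', one_mul]
  have h2 : quadraticChar (ZMod p) ((-(m * d') * -D : ℤ) : ZMod p) =
      quadraticChar (ZMod p) (w ^ 2 * ((-(m * d') * -D : ℤ) : ZMod p)) := by
    rw [map_mul, quadraticChar_sq_one' hw, one_mul]
  rw [h1, h2]
  congr 1
  push_cast
  linear_combination (-(D : ZMod p) * m) * h

/-- Local densities of a ternary lattice stable at an odd prime `p`. -/
theorem localDensity_stable_odd (p : ℕ) (hp : p.Prime) (hp2 : p ≠ 2)
    (A : TernMat) (hA : IsLat A) (hprim : IsPrimitiveLat A) (hst : StableAt A p)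
    (n : ℕ) (hn : 0 < n) :
    letI : Fact p.Prime := ⟨hp⟩
    (padicValInt p A.det = 0 →
      (Even (padicValNat p n) →
        localDensity p hp n A =
          1 + 1 / (p : ℝ) - 1 / (p : ℝ) ^ ((padicValNat p n + 2) / 2) +
            (legendreSym p (-((n : ℤ) / (p : ℤ) ^ padicValNat p n * A.det)) : ℝ) *
              (1 / (p : ℝ) ^ ((padicValNat p n + 2) / 2))) ∧
      (¬Even (padicValNat p n) →
        localDensity p hp n A =
          1 + 1 / (p : ℝ) - 1 / (p : ℝ) ^ ((padicValNat p n + 1) / 2) -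
            1 / (p : ℝ) ^ ((padicValNat p n + 3) / 2))) ∧
    (padicValInt p A.det = 1 →
      ∀ (M : Matrix (Fin 2) (Fin 2) ℤ_[p]) (u : ℤ_[p]),
        IsUnit M.det → (p : ℤ_[p]) ∣ u →
        PadicIsomP p (padicMat p A) (blockMat3 2 (by norm_num) M (Matrix.diagonal ![u])) →
        (Even (padicValNat p n) →
          localDensity p hp n A =
            1 + (1 - 1 / (p : ℝ) ^ (padicValNat p n / 2) -
                  1 / (p : ℝ) ^ ((padicValNat p n + 2) / 2)) *
                (legendreSym p (-((PadicInt.toZMod M.det).val : ℤ)) : ℝ)) ∧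
        (¬Even (padicValNat p n) →
          localDensity p hp n A =
            1 + (1 - 1 / (p : ℝ) ^ ((padicValNat p n + 1) / 2) +
                  (legendreSym p (-((n : ℤ) * A.det / (p : ℤ) ^ (padicValNat p n + 1))) : ℝ) *
                    (1 / (p : ℝ) ^ ((padicValNat p n + 1) / 2))) *
                (legendreSym p (-((PadicInt.toZMod M.det).val : ℤ)) : ℝ))) := by
  letI : Fact p.Prime := ⟨hp⟩
  have hsym := hA.1
  have hdet0 := det_ne_zero_of_isLat A hA
  obtain ⟨m, hm⟩ : p ^ padicValNat p n ∣ n := pow_padicValNat_dvd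
  have hpm : ¬ (p : ℤ) ∣ (m : ℤ) := by
    intro h
    obtain ⟨l, rfl⟩ := Int.natCast_dvd_natCast.1 h
    refine pow_succ_padicValNat_not_dvd (p := p) hn.ne' ⟨l, ?_⟩
    rw [pow_succ, mul_assoc]; exact hm
  generalize padicValNat p n = ν at hm ⊢
  have hpz : (p : ℤ) ≠ 0 := by exact_mod_cast hp.ne_zero
  have hnz : (n : ℤ) = (p : ℤ) ^ ν * m := by exact_mod_cast hm
  refine ⟨fun h0 => ?_, fun h1 => ?_⟩
  · have hd : ¬ (p : ℤ) ∣ A.det := by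
      rw [← pow_one (p : ℤ), padicValInt_dvd_iff, h0]
      simp [hdet0]
    refine ⟨fun hev => ?_, fun hodd => ?_⟩
    · obtain ⟨k, hk⟩ := hev.exists_two_nsmul
      rw [smul_eq_mul] at hk
      subst hk
      refine localDensity_of p hp _ A _ (2 * k + 1) fun j => ?_
      rw [hnz, Int.mul_ediv_cancel_left _ (pow_ne_zero _ hpz), NN0_even p hp2 A hsym hd m hpm k j,
        show (2 * k + 2) / 2 = k + 1 by omega]
    · obtain ⟨k, hk⟩ := Nat.not_even_iff_odd.1 hodd
      subst hk
      refine localDensity_of p hp _ A _ (2 * k + 2) fun j => ?_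
      rw [hnz, NN0_odd p hp2 A hsym hd m hpm k j,
        show (2 * k + 1 + 1) / 2 = k + 1 by omega, show (2 * k + 1 + 3) / 2 = k + 2 by omega]
  · intro M u hM hu hiso
    obtain ⟨d', hd'⟩ : (p : ℤ) ∣ A.det := by
      rw [← pow_one (p : ℤ), padicValInt_dvd_iff, h1]
      simp
    have hpd' : ¬ (p : ℤ) ∣ d' := by
      rintro ⟨l, rfl⟩
      have : (p : ℤ) ^ 2 ∣ A.det := ⟨l, by rw [hd']; ring⟩
      rw [padicValInt_dvd_iff, h1] at this
      rcases this with h | h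
      · exact hdet0 h
      · omega
    have hleg : ∀ D : ℤ, (D : ZMod p) = PadicInt.toZMod M.det →
        legendreSym p (-((PadicInt.toZMod M.det).val : ℤ)) = legendreSym p (-D) := by
      intro D hD
      unfold legendreSym
      congr 1
      rw [Int.cast_neg, Int.cast_neg, hD, Int.cast_natCast, ZMod.natCast_zmod_val]
    refine ⟨fun hev => ?_, fun hodd => ?_⟩
    · obtain ⟨k, hk⟩ := hev.exists_two_nsmul
      rw [smul_eq_mul] at hk
      subst hk
      refine localDensity_of p hp _ A _ (2 * k + 1) fun j => ?_
      obtain ⟨a, b, c, u0, hD, hu0, hDM, -, hNN⟩ := padic_reduce p A hsym d' hd' hpd' M u hM hu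
        hiso (2 * k + 1 + j) (by omega)
      rw [hNN, hnz, hleg _ hDM, BB_even p a b c u0 hp2 hD hu0 m hpm k j,
        show (2 * k + 2) / 2 = k + 1 by omega, show 2 * k / 2 = k by omega]
    · obtain ⟨k, hk⟩ := Nat.not_even_iff_odd.1 hodd
      subst hk
      refine localDensity_of p hp _ A _ (2 * k + 2) fun j => ?_
      obtain ⟨a, b, c, u0, hD, hu0, hDM, ⟨w, hw, hwd⟩, hNN⟩ := padic_reduce p A hsym d' hd' hpd'
        M u hM hu hiso (2 * k + 2 + j) (by omega)
      have hq : (n : ℤ) * A.det / (p : ℤ) ^ (2 * k + 1 + 1) = m * d' := by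
        rw [hnz, hd', show (p : ℤ) ^ (2 * k + 1) * m * (p * d') =
          (p : ℤ) ^ (2 * k + 1 + 1) * (m * d') by ring,
          Int.mul_ediv_cancel_left _ (pow_ne_zero _ hpz)]
      rw [hq, hNN, hnz, hleg _ hDM, BB_odd p a b c u0 hp2 hD hu0 m hpm k j,
        legendre_rel p m d' _ u0 w hw hD hwd, show (2 * k + 1 + 1) / 2 = k + 1 by omega]
      push_cast
      ring
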